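/- arXiv:1402.5132 — 2 statements merged into one kernel-verified Lean document; each statement's English description precedes it below -/
import Mathlib

section
/- Suppose that F, G, H are nonnegative measurable functions on ℝ such that F((1−λ)x + λy) ≤ G(x)^{1−λ} H(y)^{λ} for all x, y ∈ ℝ and all λ ∈ [0,1]. Then for any m₀, m₁ > 0 and any λ ∈ [0,1], writing m_λ = (1−λ)m₀ + λm₁, one has (E[F(z)^{m_λ}])^{1/m_λ} ≤ (E[G(z)^{m₀}])^{(1−λ)/m₀} · (E[H(z)^{m₁}])^{λ/m₁}, where z is a standard Gaussian random variable. -/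
open MeasureTheory ProbabilityTheory Real Set
open scoped ENNReal NNReal

lemma bdd_integrable {μ : Measure ℝ} [IsFiniteMeasure μ] {k : ℝ → ℝ} (hk : Measurable k) {K : ℝ}
    (h : ∀ x, |k x| ≤ K) : Integrable k μ :=
  Integrable.of_bound hk.aestronglyMeasurable K (ae_of_all _ h)

/-- Cameron Martin in dimension one. -/
lemma gauss_shift (k : ℝ → ℝ) (t : ℝ) :
    ∫ ξ, k ξ ∂(gaussianReal 0 1) =
      ∫ ξ, k (ξ + t) * exp (-t * ξ - t ^ 2 / 2) ∂(gaussianReal 0 1) := by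
  rw [integral_gaussianReal_eq_integral_smul (by simp), integral_gaussianReal_eq_integral_smul (by simp)]
  rw [← integral_add_right_eq_self _ t]
  refine integral_congr_ae (ae_of_all _ fun x => ?_)
  simp only [gaussianPDFReal, smul_eq_mul, NNReal.coe_one]
  have : exp (-(x + t - 0) ^ 2 / (2 * 1)) = exp (-(x - 0) ^ 2 / (2 * 1)) * exp (-t * x - t ^ 2 / 2) := by
    rw [← exp_add]; congr 1; ring
  rw [this]; ring

lemma gauss_scale (k : ℝ → ℝ) (hk : Measurable k) (ε : ℝ≥0) :
    ∫ y, k y ∂(gaussianReal 0 (ε ^ 2)) = ∫ ξ, k (ε * ξ) ∂(gaussianReal 0 1) := by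
  have h := gaussianReal_map_const_mul (μ := 0) (v := 1) (ε : ℝ)
  have h2 : gaussianReal ((ε:ℝ) * 0) (NNReal.mk ((ε:ℝ) ^ 2) (sq_nonneg _) * 1) = gaussianReal 0 (ε ^ 2) := by
    congr 1
    · simp
    · ext; simp
  rw [h2] at h
  rw [← h, integral_map (by fun_prop) hk.aestronglyMeasurable]

lemma gauss_id_int : Integrable (fun ξ : ℝ => ξ) (gaussianReal 0 1) :=
  (memLp_id_gaussianReal (μ := 0) (v := 1) 1).integrable (by simp)

lemma gauss_sq_int : Integrable (fun ξ : ℝ => ξ ^ 2) (gaussianReal 0 1) :=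
  (memLp_id_gaussianReal (μ := 0) (v := 1) 2).integrable_sq

lemma gauss_sq : ∫ ξ : ℝ, ξ ^ 2 ∂(gaussianReal 0 1) = 1 := by
  have h := variance_id_gaussianReal (μ := 0) (v := 1)
  rw [variance_of_integral_eq_zero (by fun_prop) (by simp [integral_id_gaussianReal])] at h
  simpa using h

lemma gauss_cube_int : Integrable (fun ξ : ℝ => |ξ| ^ 3) (gaussianReal 0 1) := by
  have h := (memLp_id_gaussianReal (μ := 0) (v := 1) 3).integrable_norm_pow (by simp)
  simpa using h

lemma exp_shift_int (t c : ℝ) : Integrable (fun ξ : ℝ => exp (-t * ξ - c)) (gaussianReal 0 1) := by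
  have h := integrable_exp_mul_gaussianReal (μ := 0) (v := 1) (-t)
  simp_rw [sub_eq_add_neg, exp_add]
  exact h.mul_const _

/-- Variational lower bound. -/
lemma lower_bd (u : ℝ → ℝ) (hu : Measurable u) (K : ℝ) (hK : ∀ x, |u x| ≤ K) (x ε b : ℝ) :
    ∫ ξ, u (x + ε * ξ + b * ε ^ 2) ∂(gaussianReal 0 1) - b ^ 2 * ε ^ 2 / 2 ≤
      log (∫ ξ, exp (u (x + ε * ξ)) ∂(gaussianReal 0 1)) := by
  have hu1 : Integrable (fun ξ => u (x + ε * ξ + b * ε ^ 2)) (gaussianReal 0 1) :=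
    bdd_integrable (by fun_prop) (fun ξ => hK _)
  have h1 := gauss_shift (fun ξ => exp (u (x + ε * ξ))) (b * ε)
  have h2 : ∀ ξ, exp (u (x + ε * (ξ + b * ε))) * exp (-(b * ε) * ξ - (b * ε) ^ 2 / 2)
      = exp (u (x + ε * ξ + b * ε ^ 2) + (-(b * ε) * ξ - (b * ε) ^ 2 / 2)) := by
    intro ξ
    rw [exp_add]; congr 3; ring
  simp_rw [h2] at h1
  have hlin : Integrable (fun ξ : ℝ => -(b * ε) * ξ - (b * ε) ^ 2 / 2) (gaussianReal 0 1) :=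
    (gauss_id_int.const_mul _).sub (integrable_const _)
  have hpos : 0 < ∫ ξ, exp (u (x + ε * ξ)) ∂(gaussianReal 0 1) := by
    apply integral_exp_pos
    exact bdd_integrable (by fun_prop) (K := exp K) (fun ξ => by
      rw [abs_of_pos (exp_pos _)]; exact exp_le_exp.2 (le_trans (le_abs_self _) (hK _)))
  rw [le_log_iff_exp_le hpos, h1]
  have hJ := convexOn_exp.map_integral_le (μ := gaussianReal 0 1)
    (f := fun ξ => u (x + ε * ξ + b * ε ^ 2) + (-(b * ε) * ξ - (b * ε) ^ 2 / 2))
    continuous_exp.continuousOn isClosed_univ (by simp) (hu1.add hlin) (by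
      have : Integrable (fun ξ => exp (u (x + ε * ξ + b * ε ^ 2)) * exp (-(b * ε) * ξ - (b * ε) ^ 2 / 2)) (gaussianReal 0 1) := by
        refine (exp_shift_int (b * ε) _).bdd_mul (c := exp K) (Measurable.aestronglyMeasurable (by fun_prop)) (ae_of_all _ fun ξ => ?_)
        rw [norm_of_nonneg (exp_pos _).le]
        exact exp_le_exp.2 (le_trans (le_abs_self _) (hK _))
      simpa [Function.comp_def, exp_add] using this)
  refine le_trans (le_of_eq ?_) hJ
  rw [integral_add hu1 hlin, integral_sub (gauss_id_int.const_mul _) (integrable_const _),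
    integral_const_mul, integral_id_gaussianReal]
  simp
  ring

/-- Third-order lower bound for the logarithm. -/
lemma log_lower (r c : ℝ) (hc : 0 < c) (hr : c ≤ 1 + r) :
    r - r ^ 2 / 2 - (4 + 8 * |log c|) * |r| ^ 3 ≤ log (1 + r) := by
  have h3 : 0 ≤ |r| ^ 3 := by positivity
  by_cases h : |r| ≤ 1 / 2
  · have h1 := abs_log_sub_add_sum_range_le (x := -r) (by rw [abs_neg]; linarith) 2
    simp [Finset.sum_range_succ] at h1
    have h2 : |r| ^ 3 / (1 - |r|) ≤ 2 * |r| ^ 3 := by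
      rw [div_le_iff₀ (by linarith)]
      nlinarith
    have h4 := (abs_le.1 (h1.trans h2)).1
    have : 0 ≤ |log c| * |r| ^ 3 := by positivity
    norm_num at h4
    nlinarith
  · push Not at h
    have h4 : log c ≤ log (1 + r) := log_le_log hc hr
    have h5 := neg_abs_le (log c)
    have h6 : 1 / 8 ≤ |r| ^ 3 := by
      calc (1:ℝ) / 8 = (1 / 2) ^ 3 := by norm_num
        _ ≤ _ := by gcongr
    have h7 : |r| ≤ 4 * |r| ^ 3 := by
      have : 1 / 4 ≤ |r| ^ 2 := by
        calc (1:ℝ) / 4 = (1 / 2) ^ 2 := by norm_num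
          _ ≤ _ := by gcongr
      nlinarith [abs_nonneg r]
    have h8 := le_abs_self r
    have : |log c| * (1 / 8) ≤ |log c| * |r| ^ 3 := by gcongr
    nlinarith [sq_nonneg r]

lemma ptwise (a D r1 r2 ε ξ : ℝ) (hD : 1 ≤ D) (hε : 0 ≤ ε) (hε1 : ε ≤ 1) (ha : |a| ≤ D)
    (h1 : |r2| ≤ D * |ε * ξ + a * ε ^ 2|)
    (h2 : |r2 - a * (ε * ξ + a * ε ^ 2)| ≤ D * (ε * ξ + a * ε ^ 2) ^ 2)
    (h3 : a ^ 2 * ε ^ 2 - D * (|a| * |ε * ξ| * ε ^ 2 + a ^ 2 * ε ^ 4) ≤ r2 - r1)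
    (h4 : D⁻¹ ≤ 1 + r2) :
    r1 + a ^ 2 * ε ^ 2 - a ^ 2 * ε ^ 2 * ξ ^ 2 / 2 - a ^ 3 * ε ^ 3 * ξ
      - (D ^ 2 + D ^ 3 + D ^ 4 + (D ^ 2 + (4 + 8 * |log D⁻¹|) * D ^ 3) * (4 * D ^ 3))
        * ε ^ 3 * (1 + |ξ| ^ 3) ≤ log (1 + r2) := by
  have hD0 : 0 < D := by linarith
  have hl := log_lower r2 D⁻¹ (by positivity) h4
  set K := 4 + 8 * |log D⁻¹| with hK
  have hK0 : 0 ≤ K := by positivity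
  set S := ε * ξ + a * ε ^ 2 with hS
  set B := 1 + |ξ| ^ 3 with hB
  have hx := abs_nonneg ξ
  have hB1 : 1 ≤ B := by simp [hB]
  have hxB : |ξ| ≤ B := by
    rw [hB]; nlinarith [sq_nonneg (|ξ| - 1), sq_nonneg (|ξ|), mul_nonneg hx (sq_nonneg (|ξ| - 1))]
  have hSb : |S| ≤ ε * (|ξ| + D) := by
    calc |S| ≤ |ε * ξ| + |a * ε ^ 2| := abs_add_le _ _
      _ = ε * |ξ| + |a| * (ε * ε) := by rw [abs_mul, abs_mul, abs_of_nonneg hε, abs_of_nonneg (sq_nonneg ε)]; ring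
      _ ≤ ε * |ξ| + D * (ε * 1) := by gcongr
      _ = _ := by ring
  have hcube : (|ξ| + D) ^ 3 ≤ 4 * D ^ 3 * B := by
    have e1 : (|ξ| + D) ^ 3 ≤ 4 * (|ξ| ^ 3 + D ^ 3) := by
      nlinarith [mul_nonneg (add_nonneg hx hD0.le) (sq_nonneg (|ξ| - D))]
    have e2 : 1 ≤ D ^ 3 := one_le_pow₀ hD
    have e3 : 0 ≤ |ξ| ^ 3 := by positivity
    rw [hB]
    nlinarith
  have hS3 : |S| ^ 3 ≤ ε ^ 3 * (4 * D ^ 3 * B) := by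
    calc |S| ^ 3 ≤ (ε * (|ξ| + D)) ^ 3 := by gcongr
      _ = ε ^ 3 * (|ξ| + D) ^ 3 := by ring
      _ ≤ _ := by gcongr
  have hr3 : |r2| ^ 3 ≤ D ^ 3 * |S| ^ 3 := by
    rw [← mul_pow]; gcongr
  have hr2 : r2 ^ 2 - a ^ 2 * S ^ 2 ≤ 2 * D ^ 2 * |S| ^ 3 := by
    have e1 : |r2 + a * S| ≤ 2 * D * |S| := by
      calc |r2 + a * S| ≤ |r2| + |a * S| := abs_add_le _ _
        _ = |r2| + |a| * |S| := by rw [abs_mul]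
        _ ≤ D * |S| + D * |S| := by gcongr
        _ = _ := by ring
    calc r2 ^ 2 - a ^ 2 * S ^ 2 = (r2 - a * S) * (r2 + a * S) := by ring
      _ ≤ |(r2 - a * S) * (r2 + a * S)| := le_abs_self _
      _ = |r2 - a * S| * |r2 + a * S| := abs_mul _ _
      _ ≤ (D * S ^ 2) * (2 * D * |S|) := by gcongr
      _ = _ := by rw [← sq_abs S]; ring
  have hS2 : a ^ 2 * S ^ 2 = a ^ 2 * ε ^ 2 * ξ ^ 2 + 2 * (a ^ 3 * ε ^ 3 * ξ) + a ^ 4 * ε ^ 4 := by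
    rw [hS]; ring
  have he4 : ε ^ 4 ≤ ε ^ 3 := pow_le_pow_of_le_one hε hε1 (by norm_num)
  have ha2 : a ^ 2 ≤ D ^ 2 := by rw [← sq_abs a]; gcongr
  have ha4 : a ^ 4 ≤ D ^ 4 := by
    calc a ^ 4 = (a ^ 2) ^ 2 := by ring
      _ ≤ (D ^ 2) ^ 2 := by gcongr
      _ = _ := by ring
  have t1 : a ^ 4 * ε ^ 4 ≤ D ^ 4 * ε ^ 3 * B := by
    calc a ^ 4 * ε ^ 4 ≤ D ^ 4 * ε ^ 3 := by gcongr
      _ = D ^ 4 * ε ^ 3 * 1 := by ring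
      _ ≤ _ := by gcongr
  have t1' : 0 ≤ a ^ 4 * ε ^ 4 := by positivity
  have t2 : D * (|a| * |ε * ξ| * ε ^ 2) ≤ D ^ 2 * ε ^ 3 * B := by
    calc D * (|a| * |ε * ξ| * ε ^ 2) = D * (|a| * (ε * |ξ|) * ε ^ 2) := by rw [abs_mul, abs_of_nonneg hε]
      _ ≤ D * (D * (ε * B) * ε ^ 2) := by gcongr
      _ = _ := by ring
  have t3 : D * (a ^ 2 * ε ^ 4) ≤ D ^ 3 * ε ^ 3 * B := by
    calc D * (a ^ 2 * ε ^ 4) ≤ D * (D ^ 2 * ε ^ 3) := by gcongr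
      _ = D ^ 3 * ε ^ 3 * 1 := by ring
      _ ≤ _ := by gcongr
  have t4 : K * |r2| ^ 3 ≤ K * D ^ 3 * (ε ^ 3 * (4 * D ^ 3 * B)) := by
    calc K * |r2| ^ 3 ≤ K * (D ^ 3 * (ε ^ 3 * (4 * D ^ 3 * B))) := by gcongr; exact hr3.trans (by gcongr)
      _ = _ := by ring
  have t5 : D ^ 2 * |S| ^ 3 ≤ D ^ 2 * (ε ^ 3 * (4 * D ^ 3 * B)) := by gcongr
  nlinarith

structure Nice (c M : ℝ) (φ ψ : ℝ → ℝ) : Prop where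
  hc : 0 < c
  lb : ∀ x, c ≤ φ x
  ub : ∀ x, φ x ≤ M
  lip : ∀ x s, |φ (x + s) - φ x| ≤ M * |s|
  psib : ∀ x, |ψ x| ≤ M
  psil : ∀ x s, |ψ (x + s) - ψ x| ≤ M * |s|
  tay : ∀ x s, |φ (x + s) - φ x - ψ x * s| ≤ M * s ^ 2
  mphi : Measurable φ
  mpsi : Measurable ψ

lemma upper_bd (c M : ℝ) (hc : 0 < c) : ∃ C : ℝ, 0 ≤ C ∧ ∀ φ ψ : ℝ → ℝ, Nice c M φ ψ → ∀ z ε : ℝ,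
    0 ≤ ε → ε ≤ 1 → 
    log (∫ ξ, φ (z + ε * ξ) ∂(gaussianReal 0 1)) ≤
      ∫ ξ, log (φ (z + ε * ξ + (ψ z / φ z) * ε ^ 2)) ∂(gaussianReal 0 1)
        - (ψ z / φ z) ^ 2 * ε ^ 2 / 2 + C * ε ^ 3 := by
  obtain ⟨D, hD1, hDM⟩ : ∃ D : ℝ, 1 ≤ D ∧ M ≤ D * c :=
    ⟨max 1 (M / c), le_max_left _ _, by rw [← div_le_iff₀ hc]; exact le_max_right _ _⟩
  have hD0 : 0 < D := by linarith
  set C0 := D ^ 2 + D ^ 3 + D ^ 4 + (D ^ 2 + (4 + 8 * |log D⁻¹|) * D ^ 3) * (4 * D ^ 3) with hC0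
  have hC0n : 0 ≤ C0 := by positivity
  have hI : Integrable (fun ξ : ℝ => 1 + |ξ| ^ 3) (gaussianReal 0 1) :=
    (integrable_const _).add gauss_cube_int
  refine ⟨C0 * ∫ ξ : ℝ, (1 + |ξ| ^ 3) ∂(gaussianReal 0 1), 
    mul_nonneg hC0n (integral_nonneg fun ξ => by positivity), ?_⟩
  intro φ ψ hN z ε hε hε1
  have hM0 : 0 < M := hc.trans_le ((hN.lb 0).trans (hN.ub 0))
  have hp : ∀ x, 0 < φ x := fun x => hc.trans_le (hN.lb x)
  set a := ψ z / φ z with ha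
  have hz := hp z
  have hMz : M ≤ D * φ z := hDM.trans (by gcongr; exact hN.lb z)
  have key : ∀ A t : ℝ, |A| ≤ M * t → 0 ≤ t → |A / φ z| ≤ D * t := by
    intro A t hA ht
    rw [abs_div, abs_of_pos hz, div_le_iff₀ hz]
    calc |A| ≤ M * t := hA
      _ ≤ D * φ z * t := by gcongr
      _ = _ := by ring
  have haD : |a| ≤ D := by
    have := key (ψ z) 1 (by simpa using hN.psib z) (by norm_num)
    simpa using this
  have hpsi : ψ z = a * φ z := by rw [ha]; field_simp
  have pt : ∀ ξ : ℝ, log (φ z) + ((φ (z + ε * ξ) / φ z - 1) + a ^ 2 * ε ^ 2 - a ^ 2 * ε ^ 2 * ξ ^ 2 / 2 - a ^ 3 * ε ^ 3 * ξ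
      - C0 * ε ^ 3 * (1 + |ξ| ^ 3)) ≤ log (φ (z + ε * ξ + a * ε ^ 2)) := by
    intro ξ
    have h := ptwise a D (φ (z + ε * ξ) / φ z - 1) (φ (z + ε * ξ + a * ε ^ 2) / φ z - 1) ε ξ hD1 hε hε1 haD
      (by
        have := key _ _ (hN.lip z (ε * ξ + a * ε ^ 2)) (abs_nonneg _)
        rw [← add_assoc] at this
        rwa [sub_div, div_self hz.ne'] at this)
      (by
        have := key _ _ (hN.tay z (ε * ξ + a * ε ^ 2)) (sq_nonneg _)
        rw [← add_assoc] at this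
        rwa [sub_div, sub_div, div_self hz.ne', mul_div_right_comm, ← ha] at this)
      (by
        have e1 := (abs_le.1 (hN.tay (z + ε * ξ) (a * ε ^ 2))).1
        have e2 : |ψ (z + ε * ξ) - ψ z| * |a * ε ^ 2| ≤ M * |ε * ξ| * |a * ε ^ 2| := by
          gcongr; exact hN.psil z _
        rw [← abs_mul] at e2
        have e3 := (abs_le.1 e2).1
        rw [abs_mul a, abs_of_nonneg (sq_nonneg ε)] at e3
        have e4 : a ^ 2 * ε ^ 2 * φ z - M * (|a| * |ε * ξ| * ε ^ 2 + a ^ 2 * ε ^ 4) ≤ 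
            φ (z + ε * ξ + a * ε ^ 2) - φ (z + ε * ξ) := by
          rw [hpsi] at e3
          nlinarith
        have e5 : M * (|a| * |ε * ξ| * ε ^ 2 + a ^ 2 * ε ^ 4) ≤ D * φ z * (|a| * |ε * ξ| * ε ^ 2 + a ^ 2 * ε ^ 4) := by
          gcongr
        have e6 : φ (z + ε * ξ + a * ε ^ 2) / φ z - 1 - (φ (z + ε * ξ) / φ z - 1) 
          = (φ (z + ε * ξ + a * ε ^ 2) - φ (z + ε * ξ)) / φ z := by ring
        rw [e6, le_div_iff₀ hz]
        nlinarith)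
      (by
        have : D⁻¹ ≤ φ (z + ε * ξ + a * ε ^ 2) / φ z := by
          rw [le_div_iff₀ hz, inv_mul_le_iff₀ hD0]
          exact (hN.ub z).trans (hDM.trans (by gcongr; exact hN.lb _))
        linarith)
    have e : φ (z + ε * ξ + a * ε ^ 2) = φ z * (1 + (φ (z + ε * ξ + a * ε ^ 2) / φ z - 1)) := by
      field_simp; ring
    rw [e, log_mul hz.ne']
    · linarith
    · have : 0 < φ (z + ε * ξ + a * ε ^ 2) / φ z := div_pos (hp _) hz
      linarith
  have mφ := hN.mphi
  have i1 : Integrable (fun ξ => φ (z + ε * ξ)) (gaussianReal 0 1) :=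
    bdd_integrable (by fun_prop) (K := M) (fun ξ => by rw [abs_of_pos (hp _)]; exact hN.ub _)
  have i2 : Integrable (fun ξ => log (φ (z + ε * ξ + a * ε ^ 2))) (gaussianReal 0 1) := by
    refine bdd_integrable (by fun_prop) (K := |log c| + |log M|) (fun ξ => ?_)
    have b1 := log_le_log hc (hN.lb (z + ε * ξ + a * ε ^ 2))
    have b2 := log_le_log (hp _) (hN.ub (z + ε * ξ + a * ε ^ 2))
    rw [abs_le]
    constructor
    · linarith [neg_abs_le (log c), abs_nonneg (log M)]
    · linarith [le_abs_self (log M), abs_nonneg (log c)]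
  have i3 : Integrable (fun ξ : ℝ => φ (z + ε * ξ) / φ z - 1 + a ^ 2 * ε ^ 2 - a ^ 2 * ε ^ 2 * ξ ^ 2 / 2
      - a ^ 3 * ε ^ 3 * ξ) (gaussianReal 0 1) :=
    ((((i1.div_const (φ z)).sub (integrable_const 1)).add (integrable_const (a ^ 2 * ε ^ 2))).sub
      ((gauss_sq_int.const_mul (a ^ 2 * ε ^ 2)).div_const 2)).sub (gauss_id_int.const_mul (a ^ 3 * ε ^ 3))
  have i4 : Integrable (fun ξ : ℝ => φ (z + ε * ξ) / φ z - 1 + a ^ 2 * ε ^ 2 - a ^ 2 * ε ^ 2 * ξ ^ 2 / 2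
      - a ^ 3 * ε ^ 3 * ξ - C0 * ε ^ 3 * (1 + |ξ| ^ 3)) (gaussianReal 0 1) :=
    i3.sub (hI.const_mul (C0 * ε ^ 3))
  have hint := integral_mono ((integrable_const (log (φ z))).add i4) i2 (fun ξ => pt ξ)
  have hcomp : ∫ ξ, (log (φ z) + ((φ (z + ε * ξ) / φ z - 1) + a ^ 2 * ε ^ 2 - a ^ 2 * ε ^ 2 * ξ ^ 2 / 2 - a ^ 3 * ε ^ 3 * ξ
      - C0 * ε ^ 3 * (1 + |ξ| ^ 3))) ∂(gaussianReal 0 1) =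
      log (φ z) + (((∫ ξ, φ (z + ε * ξ) ∂(gaussianReal 0 1)) / φ z - 1) + a ^ 2 * ε ^ 2 - a ^ 2 * ε ^ 2 / 2
      - C0 * ε ^ 3 * ∫ ξ : ℝ, (1 + |ξ| ^ 3) ∂(gaussianReal 0 1)) := by
    rw [integral_add (integrable_const _) i4, integral_sub i3 (hI.const_mul _), integral_sub _ (gauss_id_int.const_mul _),
      integral_sub _ ((gauss_sq_int.const_mul _).div_const 2), integral_add _ (integrable_const _),
      integral_sub (i1.div_const _) (integrable_const _), integral_div, integral_div, integral_const_mul, integral_const_mul, 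
      integral_const_mul, gauss_sq, integral_id_gaussianReal]
    · simp only [mul_zero, mul_one, integral_const, probReal_univ, smul_eq_mul, one_mul, sub_zero]
      rw [integral_const_mul]
    · exact (i1.div_const _).sub (integrable_const _)
    · exact ((i1.div_const _).sub (integrable_const _)).add (integrable_const _)
    · exact (((i1.div_const _).sub (integrable_const _)).add (integrable_const _)).sub ((gauss_sq_int.const_mul _).div_const 2)
  have hJpos : 0 < ∫ ξ, φ (z + ε * ξ) ∂(gaussianReal 0 1) := by
    have : c ≤ ∫ ξ, φ (z + ε * ξ) ∂(gaussianReal 0 1) := by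
      have := integral_mono (integrable_const c) i1 (fun ξ => hN.lb _)
      simpa using this
    linarith
  have hlog : log (∫ ξ, φ (z + ε * ξ) ∂(gaussianReal 0 1)) ≤ log (φ z) + ((∫ ξ, φ (z + ε * ξ) ∂(gaussianReal 0 1)) / φ z - 1) := by
    have := log_le_sub_one_of_pos (div_pos hJpos hz)
    rw [log_div hJpos.ne' hz.ne'] at this
    linarith
  have hint' := hcomp.symm.le.trans hint
  linarith

/-- Heat semigroup. -/
noncomputable def heatQ (v : ℝ≥0) (φ : ℝ → ℝ) (x : ℝ) : ℝ := ∫ y, φ (x + y) ∂(gaussianReal 0 v)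

lemma heatQ_meas (v : ℝ≥0) (φ : ℝ → ℝ) (hφ : Measurable φ) : Measurable (heatQ v φ) := by
  have : StronglyMeasurable (fun p : ℝ × ℝ => φ (p.1 + p.2)) :=
    Measurable.stronglyMeasurable (by fun_prop)
  exact (this.integral_prod_right' (ν := gaussianReal 0 v)).measurable

lemma heatQ_int (v : ℝ≥0) (φ : ℝ → ℝ) (hφ : Measurable φ) (K : ℝ) (h : ∀ x, |φ x| ≤ K) (x : ℝ) :
    Integrable (fun y => φ (x + y)) (gaussianReal 0 v) :=
  bdd_integrable (by fun_prop) (fun y => h _)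

lemma heatQ_abs (v : ℝ≥0) (φ : ℝ → ℝ) (K : ℝ) (h : ∀ x, |φ x| ≤ K) (x : ℝ) :
    |heatQ v φ x| ≤ K := by
  have := norm_integral_le_of_norm_le_const (μ := gaussianReal 0 v) (f := fun y => φ (x + y)) (C := K)
    (ae_of_all _ fun y => h _)
  simpa [heatQ] using this

lemma heatQ_lb (v : ℝ≥0) (φ : ℝ → ℝ) (hφ : Measurable φ) (K : ℝ) (h : ∀ x, |φ x| ≤ K) (c : ℝ)
    (hc : ∀ x, c ≤ φ x) (x : ℝ) : c ≤ heatQ v φ x := by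
  have := integral_mono (integrable_const c) (heatQ_int v φ hφ K h x) (fun ξ => hc _)
  simpa [heatQ] using this

lemma heatQ_semi (v w : ℝ≥0) (φ : ℝ → ℝ) (hφ : Measurable φ) (K : ℝ) (h : ∀ x, |φ x| ≤ K) (x : ℝ) :
    heatQ (v + w) φ x = heatQ w (heatQ v φ) x := by
  have h1 := gaussianReal_conv_gaussianReal (m₁ := 0) (m₂ := 0) (v₁ := w) (v₂ := v)
  rw [add_zero, add_comm w v] at h1
  unfold heatQ
  rw [← h1, integral_conv]
  · simp_rw [add_assoc]
  · rw [h1]; exact heatQ_int _ φ hφ K h x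

lemma nice_heatQ {c M : ℝ} {φ ψ : ℝ → ℝ} (hN : Nice c M φ ψ) (v : ℝ≥0) :
    Nice c M (heatQ v φ) (heatQ v ψ) := by
  have hφb : ∀ x, |φ x| ≤ M := fun x => by
    rw [abs_of_pos (hN.hc.trans_le (hN.lb x))]; exact hN.ub x
  have iφ := heatQ_int v φ hN.mphi M hφb
  have iψ := heatQ_int v ψ hN.mpsi M hN.psib
  refine ⟨hN.hc, heatQ_lb v φ hN.mphi M hφb c hN.lb, 
    fun x => (le_abs_self _).trans (heatQ_abs v φ M hφb x), ?_, heatQ_abs v ψ M hN.psib, ?_, ?_,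
    heatQ_meas v φ hN.mphi, heatQ_meas v ψ hN.mpsi⟩
  · intro x s
    unfold heatQ
    rw [← integral_sub (iφ _) (iφ _)]
    have := norm_integral_le_of_norm_le_const (μ := gaussianReal 0 v)
      (f := fun y => φ (x + s + y) - φ (x + y)) (C := M * |s|)
      (ae_of_all _ fun y => by rw [add_right_comm]; exact hN.lip _ _)
    simpa using this
  · intro x s
    unfold heatQ
    rw [← integral_sub (iψ _) (iψ _)]
    have := norm_integral_le_of_norm_le_const (μ := gaussianReal 0 v)
      (f := fun y => ψ (x + s + y) - ψ (x + y)) (C := M * |s|)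
      (ae_of_all _ fun y => by rw [add_right_comm]; exact hN.psil _ _)
    simpa using this
  · intro x s
    unfold heatQ
    rw [← integral_mul_const, ← integral_sub (iφ _) (iφ _), ← integral_sub _ ((iψ _).mul_const _)]
    · have := norm_integral_le_of_norm_le_const (μ := gaussianReal 0 v)
        (f := fun y => φ (x + s + y) - φ (x + y) - ψ (x + y) * s) (C := M * s ^ 2)
        (ae_of_all _ fun y => by rw [add_right_comm]; exact hN.tay _ _)
      simpa using this
    · exact (iφ _).sub (iφ _)

lemma one_step {c M C : ℝ} (hC : ∀ φ ψ : ℝ → ℝ, Nice c M φ ψ → ∀ z ε : ℝ,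
    0 ≤ ε → ε ≤ 1 → 
    log (∫ ξ, φ (z + ε * ξ) ∂(gaussianReal 0 1)) ≤
      ∫ ξ, log (φ (z + ε * ξ + (ψ z / φ z) * ε ^ 2)) ∂(gaussianReal 0 1)
        - (ψ z / φ z) ^ 2 * ε ^ 2 / 2 + C * ε ^ 3) 
    (Φ Ψ : ℝ → ℝ) (hN : Nice c M Φ Ψ) (U0 U1 : ℝ → ℝ) (hU0 : Measurable U0) (hU1 : Measurable U1)
    (K : ℝ) (hK0 : ∀ x, |U0 x| ≤ K) (hK1 : ∀ x, |U1 x| ≤ K)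
    (m₀ m₁ l e : ℝ) (hm₀ : 0 < m₀) (hm₁ : 0 < m₁) (hl : l ∈ Icc (0 : ℝ) 1)
    (h : ∀ x y, log (Φ ((1 - l) * x + l * y)) / ((1 - l) * m₀ + l * m₁) ≤
      (1 - l) / m₀ * U0 x + l / m₁ * U1 y + e) (ε : ℝ) (hε : 0 ≤ ε) (hε1 : ε ≤ 1) (x y : ℝ) :
    log (∫ ξ, Φ ((1 - l) * x + l * y + ε * ξ) ∂(gaussianReal 0 1)) / ((1 - l) * m₀ + l * m₁) ≤
      (1 - l) / m₀ * log (∫ ξ, exp (U0 (x + ε * ξ)) ∂(gaussianReal 0 1)) + 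
      l / m₁ * log (∫ ξ, exp (U1 (y + ε * ξ)) ∂(gaussianReal 0 1)) 
      + (e + C * ε ^ 3 / ((1 - l) * m₀ + l * m₁)) := by
  obtain ⟨hl0, hl1⟩ := hl
  have hm : 0 < (1 - l) * m₀ + l * m₁ := by
    rcases hl0.eq_or_lt with h0 | h0
    · rw [← h0]; linarith
    · nlinarith [mul_pos h0 hm₁, mul_nonneg (sub_nonneg.2 hl1) hm₀.le]
  set m := (1 - l) * m₀ + l * m₁ with hmdef
  set z := (1 - l) * x + l * y with hz
  set a := Ψ z / Φ z with ha
  have hB := hC Φ Ψ hN z ε hε hε1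
  rw [← ha] at hB
  have hA0 := lower_bd U0 hU0 K hK0 x ε (m₀ * (a / m))
  have hA1 := lower_bd U1 hU1 K hK1 y ε (m₁ * (a / m))
  have iU0 : Integrable (fun ξ => U0 (x + ε * ξ + m₀ * (a / m) * ε ^ 2)) (gaussianReal 0 1) :=
    bdd_integrable (by fun_prop) (fun ξ => hK0 _)
  have iU1 : Integrable (fun ξ => U1 (y + ε * ξ + m₁ * (a / m) * ε ^ 2)) (gaussianReal 0 1) :=
    bdd_integrable (by fun_prop) (fun ξ => hK1 _)
  have mΦ := hN.mphi
  have i2 : Integrable (fun ξ => log (Φ (z + ε * ξ + a * ε ^ 2))) (gaussianReal 0 1) := by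
    refine bdd_integrable (by fun_prop) (K := |log c| + |log M|) (fun ξ => ?_)
    have b1 := log_le_log hN.hc (hN.lb (z + ε * ξ + a * ε ^ 2))
    have b2 := log_le_log (hN.hc.trans_le (hN.lb _)) (hN.ub (z + ε * ξ + a * ε ^ 2))
    rw [abs_le]
    constructor
    · linarith [neg_abs_le (log c), abs_nonneg (log M)]
    · linarith [le_abs_self (log M), abs_nonneg (log c)]
  have hmid : (∫ ξ, log (Φ (z + ε * ξ + a * ε ^ 2)) ∂(gaussianReal 0 1)) / m ≤
      (1 - l) / m₀ * ∫ ξ, U0 (x + ε * ξ + m₀ * (a / m) * ε ^ 2) ∂(gaussianReal 0 1) +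
      l / m₁ * (∫ ξ, U1 (y + ε * ξ + m₁ * (a / m) * ε ^ 2) ∂(gaussianReal 0 1)) + e := by
    have := integral_mono (i2.div_const m) (((iU0.const_mul ((1 - l) / m₀)).add
      (iU1.const_mul (l / m₁))).add (integrable_const e)) (fun ξ => by
        have h' := h (x + ε * ξ + m₀ * (a / m) * ε ^ 2) (y + ε * ξ + m₁ * (a / m) * ε ^ 2)
        have e1 : (1 - l) * (x + ε * ξ + m₀ * (a / m) * ε ^ 2) + l * (y + ε * ξ + m₁ * (a / m) * ε ^ 2)
          = z + ε * ξ + a * ε ^ 2 := by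
          have : a = m * (a / m) := by field_simp
          conv_rhs => rw [this]
          rw [hz]
          conv_rhs => rw [hmdef]
          ring
        rw [e1] at h'
        exact h')
    rw [integral_div] at this
    refine this.trans (le_of_eq ?_)
    simp only [Pi.add_apply]
    have isum : Integrable (fun ξ => (1 - l) / m₀ * U0 (x + ε * ξ + m₀ * (a / m) * ε ^ 2) +
      l / m₁ * U1 (y + ε * ξ + m₁ * (a / m) * ε ^ 2)) (gaussianReal 0 1) :=
      (iU0.const_mul _).add (iU1.const_mul _)
    rw [integral_add isum (integrable_const _),
      integral_add (iU0.const_mul _) (iU1.const_mul _), integral_const_mul, integral_const_mul]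
    simp
  have q0 := mul_le_mul_of_nonneg_left hA0 (show 0 ≤ (1 - l) / m₀ from div_nonneg (by linarith) hm₀.le)
  have q1 := mul_le_mul_of_nonneg_left hA1 (show 0 ≤ l / m₁ from div_nonneg hl0 hm₁.le)
  have q2 := div_le_div_of_nonneg_right hB hm.le
  have q3 : (1 - l) / m₀ * ((m₀ * (a / m)) ^ 2 * ε ^ 2 / 2) + l / m₁ * ((m₁ * (a / m)) ^ 2 * ε ^ 2 / 2)
      = a ^ 2 * ε ^ 2 / 2 / m := by
    have : (1 - l) / m₀ * ((m₀ * (a / m)) ^ 2 * ε ^ 2 / 2) + l / m₁ * ((m₁ * (a / m)) ^ 2 * ε ^ 2 / 2)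
      = m * ((a / m) ^ 2 * ε ^ 2 / 2) := by
      conv_rhs => rw [show m * ((a / m) ^ 2 * ε ^ 2 / 2) = ((1 - l) * m₀ + l * m₁) * ((a / m) ^ 2 * ε ^ 2 / 2) from rfl]
      generalize a / m = w
      field_simp
    rw [this]; field_simp
  rw [add_div, sub_div] at q2
  rw [mul_sub] at q0 q1
  linarith

lemma heatQ_zero (φ : ℝ → ℝ) (x : ℝ) : heatQ 0 φ x = φ x := by
  simp [heatQ, gaussianReal_zero_var]

lemma exp_bdd {u : ℝ → ℝ} {K : ℝ} (h : ∀ x, |u x| ≤ K) (x : ℝ) : |exp (u x)| ≤ exp K := by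
  rw [abs_of_pos (exp_pos _)]
  exact exp_le_exp.2 ((le_abs_self _).trans (h x))

lemma exp_lb {u : ℝ → ℝ} {K : ℝ} (h : ∀ x, |u x| ≤ K) (x : ℝ) : exp (-K) ≤ exp (u x) :=
  exp_le_exp.2 (abs_le.1 (h x)).1

lemma heatQ_log_bdd {u : ℝ → ℝ} {K : ℝ} (hu : Measurable u) (h : ∀ x, |u x| ≤ K) (v : ℝ≥0) (x : ℝ) :
    0 < heatQ v (fun x => exp (u x)) x ∧ |log (heatQ v (fun x => exp (u x)) x)| ≤ K := by
  have h1 := heatQ_lb v (fun x => exp (u x)) (by fun_prop) (exp K) (exp_bdd h) (exp (-K)) (exp_lb h) x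
  have h2 := (le_abs_self _).trans (heatQ_abs v (fun x => exp (u x)) (exp K) (exp_bdd h) x)
  have hp := (exp_pos (-K)).trans_le h1
  refine ⟨hp, abs_le.2 ⟨?_, ?_⟩⟩
  · rwa [le_log_iff_exp_le hp]
  · rwa [log_le_iff_le_exp hp]

lemma nice_core {c M : ℝ} (φ ψ : ℝ → ℝ) (hN : Nice c M φ ψ) (u0 u1 : ℝ → ℝ)
    (hu0 : Measurable u0) (hu1 : Measurable u1)
    (K : ℝ) (hK0 : ∀ x, |u0 x| ≤ K) (hK1 : ∀ x, |u1 x| ≤ K)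
    (m₀ m₁ l : ℝ) (hm₀ : 0 < m₀) (hm₁ : 0 < m₁) (hl : l ∈ Icc (0 : ℝ) 1)
    (h : ∀ x y, log (φ ((1 - l) * x + l * y)) / ((1 - l) * m₀ + l * m₁) ≤
      (1 - l) / m₀ * u0 x + l / m₁ * u1 y) :
    log (∫ ξ, φ ξ ∂(gaussianReal 0 1)) / ((1 - l) * m₀ + l * m₁) ≤
      (1 - l) / m₀ * log (∫ ξ, exp (u0 ξ) ∂(gaussianReal 0 1)) + 
      l / m₁ * log (∫ ξ, exp (u1 ξ) ∂(gaussianReal 0 1)) := by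
  obtain ⟨C, hC0, hC⟩ := upper_bd c M hN.hc
  have hφb : ∀ x, |φ x| ≤ M := fun x => by
    rw [abs_of_pos (hN.hc.trans_le (hN.lb x))]; exact hN.ub x
  have ind : ∀ ε : ℝ≥0, ε ≤ 1 → ∀ k : ℕ, ∀ x y : ℝ,
      log (heatQ (k * ε ^ 2) φ ((1 - l) * x + l * y)) / ((1 - l) * m₀ + l * m₁) ≤
      (1 - l) / m₀ * log (heatQ (k * ε ^ 2) (fun x => exp (u0 x)) x) + 
      l / m₁ * log (heatQ (k * ε ^ 2) (fun x => exp (u1 x)) y) + 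
        k * (C * (ε : ℝ) ^ 3 / ((1 - l) * m₀ + l * m₁)) := by
    intro ε hε k
    induction k with
    | zero =>
      intro x y
      simpa [heatQ_zero] using h x y
    | succ k ih =>
      intro x y
      have hb0 := heatQ_log_bdd hu0 hK0 (k * ε ^ 2)
      have hb1 := heatQ_log_bdd hu1 hK1 (k * ε ^ 2)
      have mm0 := heatQ_meas (k * ε ^ 2) (fun x => exp (u0 x)) (by fun_prop)
      have mm1 := heatQ_meas (k * ε ^ 2) (fun x => exp (u1 x)) (by fun_prop)
      have st := one_step hC _ _ (nice_heatQ hN (k * ε ^ 2)) 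
        (fun x => log (heatQ (k * ε ^ 2) (fun x => exp (u0 x)) x))
        (fun x => log (heatQ (k * ε ^ 2) (fun x => exp (u1 x)) x))
        (by fun_prop) (by fun_prop) K (fun x => (hb0 x).2) (fun x => (hb1 x).2) m₀ m₁ l _ hm₀ hm₁ hl ih ε ε.2 hε x y
      simp only [exp_log (hb0 _).1, exp_log (hb1 _).1] at st
      have tr : ∀ χ : ℝ → ℝ, Measurable χ → (∃ B, ∀ x, |χ x| ≤ B) → ∀ x, 
          ∫ ξ, heatQ (k * ε ^ 2) χ (x + ε * ξ) ∂(gaussianReal 0 1) = heatQ ((k + 1 : ℕ) * ε ^ 2) χ x := by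
        intro χ hχ ⟨B, hB⟩ x
        have mχ := heatQ_meas (k * ε ^ 2) χ hχ
        rw [Nat.cast_add, Nat.cast_one, add_mul, one_mul, heatQ_semi _ _ χ hχ B hB]
        conv_rhs => unfold heatQ
        exact (gauss_scale (fun y => heatQ (k * ε ^ 2) χ (x + y)) (by fun_prop) ε).symm
      rw [tr φ hN.mphi ⟨M, hφb⟩, tr _ (by fun_prop) ⟨_, exp_bdd hK0⟩, tr _ (by fun_prop) ⟨_, exp_bdd hK1⟩] at st
      refine st.trans (le_of_eq ?_)
      push_cast; ring
  have fin : ∀ j : ℕ, log (∫ ξ, φ ξ ∂(gaussianReal 0 1)) / ((1 - l) * m₀ + l * m₁) ≤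
      (1 - l) / m₀ * log (∫ ξ, exp (u0 ξ) ∂(gaussianReal 0 1)) + 
      l / m₁ * log (∫ ξ, exp (u1 ξ) ∂(gaussianReal 0 1)) + (C / ((1 - l) * m₀ + l * m₁)) * (1 / ((j : ℝ) + 1)) := by
    intro j
    have := ind (1 / ((j : ℝ≥0) + 1)) (by rw [div_le_one (by positivity)]; simp) ((j + 1) ^ 2) 0 0
    have e : (((j + 1) ^ 2 : ℕ) : ℝ≥0) * (1 / ((j : ℝ≥0) + 1)) ^ 2 = 1 := by
      push_cast; field_simp
    rw [e] at this
    simp only [heatQ, mul_zero, add_zero, zero_add] at this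
    refine this.trans (le_of_eq ?_)
    push_cast
    field_simp
  have lim := (tendsto_one_div_add_atTop_nhds_zero_nat (𝕜 := ℝ)).const_mul (C / ((1 - l) * m₀ + l * m₁))
  have lim2 := lim.const_add ((1 - l) / m₀ * log (∫ ξ, exp (u0 ξ) ∂(gaussianReal 0 1)) + 
      l / m₁ * log (∫ ξ, exp (u1 ξ) ∂(gaussianReal 0 1)))
  rw [mul_zero, add_zero] at lim2
  exact ge_of_tendsto' lim2 fin

lemma lip_of_deriv {f f' : ℝ → ℝ} (hf : ∀ x, HasDerivAt f (f' x) x) {B : ℝ} (hB : ∀ x, |f' x| ≤ B)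
    (x s : ℝ) : |f (x + s) - f x| ≤ B * |s| := by
  have := Convex.norm_image_sub_le_of_norm_hasDerivWithin_le (f := f) (f' := f') (s := univ) (C := B)
    (x := x) (y := x + s) (fun x _ => (hf x).hasDerivWithinAt) (fun x _ => hB x) convex_univ (mem_univ _) (mem_univ _)
  simpa using this

lemma nice_of_deriv {φ φ1 φ2 : ℝ → ℝ} {c M : ℝ} (hc : 0 < c) (h1 : ∀ x, HasDerivAt φ (φ1 x) x)
    (h2 : ∀ x, HasDerivAt φ1 (φ2 x) x) (lb : ∀ x, c ≤ φ x) (ub : ∀ x, φ x ≤ M)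
    (b1 : ∀ x, |φ1 x| ≤ M) (b2 : ∀ x, |φ2 x| ≤ M) : Nice c M φ φ1 := by
  have c0 : Continuous φ := continuous_iff_continuousAt.2 fun x => (h1 x).continuousAt
  have c1 : Continuous φ1 := continuous_iff_continuousAt.2 fun x => (h2 x).continuousAt
  have hM : 0 ≤ M := (abs_nonneg _).trans (b1 0)
  refine ⟨hc, lb, ub, lip_of_deriv h1 b1, b1, lip_of_deriv h2 b2, ?_, c0.measurable, c1.measurable⟩
  intro x s
  have hd : ∀ t, HasDerivAt (fun t => φ (x + t) - φ1 x * t) (φ1 (x + t) - φ1 x) t := by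
    intro t
    have e1 := (h1 (x + t)).comp_const_add x t
    have e2 := (hasDerivAt_id t).const_mul (φ1 x)
    rw [mul_one] at e2
    exact e1.sub e2
  have := Convex.norm_image_sub_le_of_norm_hasDerivWithin_le (f := fun t => φ (x + t) - φ1 x * t)
    (f' := fun t => φ1 (x + t) - φ1 x) (s := Metric.closedBall 0 |s|) (C := M * |s|)
    (x := 0) (y := s) (fun t _ => (hd t).hasDerivWithinAt) (fun t ht => by
      refine (lip_of_deriv h2 b2 x t).trans ?_
      have : |t| ≤ |s| := by simpa using ht
      gcongr) (convex_closedBall _ _) (by simp) (by simp)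
  have e : M * |s| * |s| = M * s ^ 2 := by rw [← sq_abs s]; ring
  simp only [Real.norm_eq_abs, sub_zero, add_zero, mul_zero] at this
  rw [e] at this
  refine le_trans (le_of_eq ?_) this
  congr 1; ring

open scoped Convolution in
lemma mol_conv (p f : ℝ → ℝ) (x : ℝ) : 
    (p ⋆[ContinuousLinearMap.lsmul ℝ ℝ, volume] f) x = ∫ t, p t * f (x - t) := by
  simp [convolution_def]

lemma conv_int {p f : ℝ → ℝ} (hp : Integrable p) (hf : Measurable f) {K : ℝ} (hK : ∀ x, |f x| ≤ K) (x : ℝ) :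
    Integrable (fun t => p t * f (x - t)) :=
  hp.mul_bdd (c := K) (Measurable.aestronglyMeasurable (by fun_prop)) (ae_of_all _ fun t => hK _)

lemma conv_bdd {p f : ℝ → ℝ} (hp : Integrable p) {K : ℝ} (hK : ∀ x, |f x| ≤ K) (x : ℝ) :
    |∫ t, p t * f (x - t)| ≤ K * ∫ t, |p t| := by
  rw [← integral_const_mul]
  refine norm_integral_le_of_norm_le (f := fun t => p t * f (x - t)) (hp.abs.const_mul K) (ae_of_all _ fun t => ?_)
  rw [Real.norm_eq_abs, abs_mul, mul_comm]
  exact mul_le_mul_of_nonneg_right (hK _) (abs_nonneg _)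

lemma bdd_locInt {f : ℝ → ℝ} (hf : Measurable f) {K : ℝ} (hK : ∀ x, |f x| ≤ K) : LocallyIntegrable f volume := by
  refine (locallyIntegrable_const K).mono hf.aestronglyMeasurable (ae_of_all _ fun x => ?_)
  exact (hK x).trans (le_abs_self _)

lemma conv_deriv {p f : ℝ → ℝ} (hp : ContDiff ℝ 1 p) (hc : HasCompactSupport p)
    (hf : Measurable f) {K : ℝ} (hK : ∀ x, |f x| ≤ K) (x : ℝ) :
    HasDerivAt (fun x => ∫ t, p t * f (x - t)) (∫ t, deriv p t * f (x - t)) x := by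
  have := hc.hasDerivAt_convolution_left (ContinuousLinearMap.lsmul ℝ ℝ) hp (bdd_locInt hf hK) x
  rw [mol_conv] at this
  have e : (fun x => ∫ t, p t * f (x - t)) = convolution p f (ContinuousLinearMap.lsmul ℝ ℝ) volume := by
    ext y
    rw [mol_conv]
  rw [e]
  exact this

/-- The inequality when everything has been mollified. -/
lemma mol_core (p : ℝ → ℝ) (hp : ContDiff ℝ 2 p) (hpc : HasCompactSupport p) (hp0 : ∀ t, 0 ≤ p t)
    (hp1 : ∫ t, p t = 1) (f g h : ℝ → ℝ) (hf : Measurable f) (hg : Measurable g) (hh : Measurable h)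
    (K : ℝ) (hfK : ∀ x, |f x| ≤ K) (hgK : ∀ x, |g x| ≤ K) (hhK : ∀ x, |h x| ≤ K)
    (m₀ m₁ l : ℝ) (hm₀ : 0 < m₀) (hm₁ : 0 < m₁) (hl : l ∈ Icc (0 : ℝ) 1)
    (H : ∀ x y, f ((1 - l) * x + l * y) ≤ (1 - l) * g x + l * h y) :
    log (∫ ξ, exp (((1 - l) * m₀ + l * m₁) * ∫ t, p t * f (ξ - t)) ∂(gaussianReal 0 1)) / ((1 - l) * m₀ + l * m₁) ≤
      (1 - l) / m₀ * log (∫ ξ, exp (m₀ * ∫ t, p t * g (ξ - t)) ∂(gaussianReal 0 1)) + 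
      l / m₁ * log (∫ ξ, exp (m₁ * ∫ t, p t * h (ξ - t)) ∂(gaussianReal 0 1)) := by
  obtain ⟨hl0, hl1⟩ := hl
  have hm : 0 < (1 - l) * m₀ + l * m₁ := by
    rcases hl0.eq_or_lt with h0 | h0
    · rw [← h0]; linarith
    · nlinarith [mul_pos h0 hm₁, mul_nonneg (sub_nonneg.2 hl1) hm₀.le]
  set m := (1 - l) * m₀ + l * m₁ with hmdef
  have hK0 : 0 ≤ K := (abs_nonneg _).trans (hfK 0)
  have ip : Integrable p := hp.continuous.integrable_of_hasCompactSupport hpc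
  have hdp : ContDiff ℝ 1 (deriv p) := by
    have : ContDiff ℝ (1 + 1) p := by simpa [one_add_one_eq_two] using hp
    exact (contDiff_succ_iff_deriv.1 this).2.2
  have idp : Integrable (deriv p) := hdp.continuous.integrable_of_hasCompactSupport hpc.deriv
  have iddp : Integrable (deriv (deriv p)) :=
    (hdp.continuous_deriv le_rfl).integrable_of_hasCompactSupport hpc.deriv.deriv
  have hp1' : ∫ t, |p t| = 1 := by simp_rw [abs_of_nonneg (hp0 _), hp1]
  have bK : ∀ q : ℝ → ℝ, (∀ x, |q x| ≤ K) → ∀ x, |∫ t, p t * q (x - t)| ≤ K := by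
    intro q hq x
    have := conv_bdd ip hq x
    rwa [hp1', mul_one] at this
  have mq : ∀ q : ℝ → ℝ, Measurable q → (∀ x, |q x| ≤ K) → Measurable (fun x => ∫ t, p t * q (x - t)) := by
    intro q mq hq
    exact (continuous_iff_continuousAt.2 fun x => (conv_deriv (hp.of_le (by norm_num)) hpc mq hq x).continuousAt).measurable
  have D1 := conv_deriv (hp.of_le (by norm_num)) hpc hf hfK
  have D2 := conv_deriv hdp hpc.deriv hf hfK
  have B0 := bK f hfK
  have B1 := conv_bdd idp hfK
  have B2 := conv_bdd iddp hfK
  have Hc : ∀ x y, (∫ t, p t * f ((1 - l) * x + l * y - t)) ≤ (1 - l) * (∫ t, p t * g (x - t)) + l * ∫ t, p t * h (y - t) := by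
    intro x y
    rw [← integral_const_mul, ← integral_const_mul, 
      ← integral_add ((conv_int ip hg hgK x).const_mul _) ((conv_int ip hh hhK y).const_mul _)]
    refine integral_mono (conv_int ip hf hfK _) (((conv_int ip hg hgK x).const_mul _).add ((conv_int ip hh hhK y).const_mul _)) fun t => ?_
    have := mul_le_mul_of_nonneg_left (H (x - t) (y - t)) (hp0 t)
    have e : (1 - l) * (x - t) + l * (y - t) = (1 - l) * x + l * y - t := by ring
    rw [e] at this
    refine this.trans (le_of_eq ?_)
    ring
  set F := fun x => ∫ t, p t * f (x - t) with hF
  set F1 := fun x => ∫ t, deriv p t * f (x - t) with hF1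
  set F2 := fun x => ∫ t, deriv (deriv p) t * f (x - t) with hF2
  set K1 := K * ∫ t, |deriv p t| with hK1
  set K2 := K * ∫ t, |deriv (deriv p) t| with hK2
  have hK1n : 0 ≤ K1 := (abs_nonneg _).trans (B1 0)
  have hK2n : 0 ≤ K2 := (abs_nonneg _).trans (B2 0)
  set E := exp (m * K) with hE
  have hE0 : 0 < E := exp_pos _
  have bE : ∀ x, exp (m * F x) ≤ E := fun x => by
    rw [hE]; gcongr; exact (le_abs_self _).trans (B0 x)
  have hN : Nice (exp (-(m * K))) (E + E * (m * K1) + (E * (m * K2) + E * (m * K1) ^ 2)) (fun x => exp (m * F x))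
      (fun x => exp (m * F x) * (m * F1 x)) := by
    refine nice_of_deriv (φ2 := fun x => exp (m * F x) * (m * F1 x) * (m * F1 x) + exp (m * F x) * (m * F2 x)) (exp_pos _)
      ?_ ?_ ?_ ?_ ?_ ?_
    · intro x
      exact ((D1 x).const_mul m).exp
    · intro x
      exact (((D1 x).const_mul m).exp).mul ((D2 x).const_mul m)
    · intro x
      apply exp_le_exp.2
      rw [← mul_neg]
      exact mul_le_mul_of_nonneg_left (abs_le.1 (B0 x)).1 hm.le
    · intro x
      have : 0 ≤ E * (m * K1) + (E * (m * K2) + E * (m * K1) ^ 2) := by positivity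
      linarith [bE x]
    · intro x
      have : |exp (m * F x) * (m * F1 x)| ≤ E * (m * K1) := by
        rw [abs_mul, abs_mul, abs_of_pos (exp_pos _), abs_of_pos hm]
        gcongr
        · exact bE x
        · exact B1 x
      have : 0 ≤ E * (m * K2) + E * (m * K1) ^ 2 := by positivity
      linarith
    · intro x
      have e1 : |exp (m * F x) * (m * F1 x) * (m * F1 x)| ≤ E * (m * K1) * (m * K1) := by
        rw [abs_mul, abs_mul, abs_mul, abs_of_pos (exp_pos _), abs_of_pos hm]
        gcongr
        · exact bE x
        · exact B1 x
        · exact B1 x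
      have e2 : |exp (m * F x) * (m * F2 x)| ≤ E * (m * K2) := by
        rw [abs_mul, abs_mul, abs_of_pos (exp_pos _), abs_of_pos hm]
        gcongr
        · exact bE x
        · exact B2 x
      have e3 : 0 ≤ E * (m * K1) := by positivity
      have := abs_add_le (exp (m * F x) * (m * F1 x) * (m * F1 x)) (exp (m * F x) * (m * F2 x))
      nlinarith
  have mg := mq g hg hgK
  have mh := mq h hh hhK
  have res := nice_core _ _ hN (fun x => m₀ * ∫ t, p t * g (x - t)) (fun x => m₁ * ∫ t, p t * h (x - t))
    (mg.const_mul _) (mh.const_mul _) (m₀ * K + m₁ * K) 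
    (fun x => by
      rw [abs_mul, abs_of_pos hm₀]
      have := mul_le_mul_of_nonneg_left (bK g hgK x) hm₀.le
      have : 0 ≤ m₁ * K := by positivity
      linarith)
    (fun x => by
      rw [abs_mul, abs_of_pos hm₁]
      have := mul_le_mul_of_nonneg_left (bK h hhK x) hm₁.le
      have : 0 ≤ m₀ * K := by positivity
      linarith) m₀ m₁ l hm₀ hm₁ ⟨hl0, hl1⟩
    (fun x y => by
      rw [log_exp, ← hmdef, mul_div_cancel_left₀ _ hm.ne']
      refine (Hc x y).trans (le_of_eq ?_)
      field_simp)
  exact res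

lemma bdd_core (f g h : ℝ → ℝ) (hf : Measurable f) (hg : Measurable g) (hh : Measurable h)
    (K : ℝ) (hfK : ∀ x, |f x| ≤ K) (hgK : ∀ x, |g x| ≤ K) (hhK : ∀ x, |h x| ≤ K)
    (m₀ m₁ l : ℝ) (hm₀ : 0 < m₀) (hm₁ : 0 < m₁) (hl : l ∈ Icc (0 : ℝ) 1)
    (H : ∀ x y, f ((1 - l) * x + l * y) ≤ (1 - l) * g x + l * h y) :
    log (∫ ξ, exp (((1 - l) * m₀ + l * m₁) * f ξ) ∂(gaussianReal 0 1)) / ((1 - l) * m₀ + l * m₁) ≤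
      (1 - l) / m₀ * log (∫ ξ, exp (m₀ * g ξ) ∂(gaussianReal 0 1)) + 
      l / m₁ * log (∫ ξ, exp (m₁ * h ξ) ∂(gaussianReal 0 1)) := by
  let ρ : ℕ → ContDiffBump (0 : ℝ) := fun n => ⟨1 / ((n : ℝ) + 1), 2 * (1 / ((n : ℝ) + 1)), by positivity, by
    have : 0 < 1 / ((n : ℝ) + 1) := by positivity
    linarith⟩
  let p : ℕ → ℝ → ℝ := fun n => (ρ n).normed volume
  have hr : Filter.Tendsto (fun n => (ρ n).rOut) Filter.atTop (nhds 0) := by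
    have := (tendsto_one_div_add_atTop_nhds_zero_nat (𝕜 := ℝ)).const_mul 2
    rw [mul_zero] at this
    exact this
  have pB : ∀ n, ∀ q : ℝ → ℝ, (∀ x, |q x| ≤ K) → ∀ x, |∫ t, p n t * q (x - t)| ≤ K := by
    intro n q hq x
    have := conv_bdd (p := p n) (ρ n).integrable_normed hq x
    have e : ∫ t, |p n t| = 1 := by
      simp_rw [p, abs_of_nonneg ((ρ n).nonneg_normed _)]
      exact (ρ n).integral_normed
    rwa [e, mul_one] at this
  have lim : ∀ q : ℝ → ℝ, Measurable q → (∀ x, |q x| ≤ K) → ∀ c : ℝ, 0 < c →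
      Filter.Tendsto (fun n => log (∫ ξ, exp (c * ∫ t, p n t * q (ξ - t)) ∂(gaussianReal 0 1))) Filter.atTop
        (nhds (log (∫ ξ, exp (c * q ξ) ∂(gaussianReal 0 1)))) := by
    intro q mq hq c hc
    have hpos : (∫ ξ, exp (c * q ξ) ∂(gaussianReal 0 1)) ≠ 0 := by
      apply ne_of_gt
      apply integral_exp_pos
      exact bdd_integrable (by fun_prop) (K := exp (c * K)) (exp_bdd fun x => by
        rw [abs_mul, abs_of_pos hc]; exact mul_le_mul_of_nonneg_left (hq x) hc.le)
    refine Filter.Tendsto.log ?_ hpos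
    have ae := ContDiffBump.ae_convolution_tendsto_right_of_locallyIntegrable (K := 2) hr
      (Filter.Eventually.of_forall fun n => le_rfl) (bdd_locInt mq hq)
    have ae' := (gaussianReal_absolutelyContinuous 0 (v := 1) (by simp)).ae_le ae
    refine tendsto_integral_of_dominated_convergence (fun _ => exp (c * K)) ?_ (integrable_const _) ?_ ?_
    · intro n
      have : Continuous (fun x => ∫ t, p n t * q (x - t)) := 
        continuous_iff_continuousAt.2 fun x => (conv_deriv (ρ n).contDiff_normed (ρ n).hasCompactSupport_normed mq hq x).continuousAt
      exact Continuous.aestronglyMeasurable (by fun_prop)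
    · intro n
      refine ae_of_all _ fun x => ?_
      rw [norm_of_nonneg (exp_pos _).le]
      gcongr
      exact (le_abs_self _).trans (pB n q hq x)
    · filter_upwards [ae'] with x hx
      simp_rw [mol_conv] at hx
      exact (continuous_exp.tendsto _).comp (hx.const_mul c)
  obtain ⟨hl0, hl1⟩ := hl
  have hm : 0 < (1 - l) * m₀ + l * m₁ := by
    rcases hl0.eq_or_lt with h0 | h0
    · rw [← h0]; linarith
    · nlinarith [mul_pos h0 hm₁, mul_nonneg (sub_nonneg.2 hl1) hm₀.le]
  refine le_of_tendsto_of_tendsto' ((lim f hf hfK _ hm).div_const _)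
    (((lim g hg hgK _ hm₀).const_mul _).add ((lim h hh hhK _ hm₁).const_mul _)) fun n => ?_
  exact mol_core (p n) (ρ n).contDiff_normed (ρ n).hasCompactSupport_normed (ρ n).nonneg_normed
    (ρ n).integral_normed f g h hf hg hh K hfK hgK hhK m₀ m₁ l hm₀ hm₁ ⟨hl0, hl1⟩ H

lemma toReal_log_facts {F : ℝ → ℝ≥0∞} (hF : Measurable F) {a b : ℝ} (ha : 0 < a)
    (h1 : ∀ x, ENNReal.ofReal a ≤ F x) (h2 : ∀ x, F x ≤ ENNReal.ofReal b) :
    Measurable (fun x => log (F x).toReal) ∧ (∀ x, |log (F x).toReal| ≤ |log a| + |log b|) ∧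
    (∀ x, F x = ENNReal.ofReal (exp (log (F x).toReal))) ∧
    ∀ m : ℝ, 0 < m → 0 < ∫ ξ, exp (m * log (F ξ).toReal) ∂(gaussianReal 0 1) ∧ 
      ∫⁻ ξ, F ξ ^ m ∂(gaussianReal 0 1) = 
        ENNReal.ofReal (∫ ξ, exp (m * log (F ξ).toReal) ∂(gaussianReal 0 1)) := by
  have hm : Measurable (fun x => log (F x).toReal) := by fun_prop
  have top : ∀ x, F x ≠ ⊤ := fun x => ((h2 x).trans_lt ENNReal.ofReal_lt_top).ne
  have l1 : ∀ x, a ≤ (F x).toReal := fun x => (ENNReal.ofReal_le_iff_le_toReal (top x)).1 (h1 x)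
  have hb : 0 < b := by
    have := (ENNReal.ofReal_pos.2 ha).trans_le ((h1 0).trans (h2 0))
    exact ENNReal.ofReal_pos.1 this
  have l2 : ∀ x, (F x).toReal ≤ b := fun x => ENNReal.toReal_le_of_le_ofReal hb.le (h2 x)
  have pos : ∀ x, 0 < (F x).toReal := fun x => ha.trans_le (l1 x)
  have hbd : ∀ x, |log (F x).toReal| ≤ |log a| + |log b| := by
    intro x
    have b1 := log_le_log ha (l1 x)
    have b2 := log_le_log (pos x) (l2 x)
    rw [abs_le]
    constructor
    · linarith [neg_abs_le (log a), abs_nonneg (log b)]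
    · linarith [le_abs_self (log b), abs_nonneg (log a)]
  have he : ∀ x, F x = ENNReal.ofReal (exp (log (F x).toReal)) := fun x => by
    rw [exp_log (pos x), ENNReal.ofReal_toReal (top x)]
  refine ⟨hm, hbd, he, fun m hm0 => ?_⟩
  have hi : Integrable (fun ξ => exp (m * log (F ξ).toReal)) (gaussianReal 0 1) :=
    bdd_integrable (by fun_prop) (exp_bdd (K := m * (|log a| + |log b|)) fun x => by
      rw [abs_mul, abs_of_pos hm0]; exact mul_le_mul_of_nonneg_left (hbd x) hm0.le)
  refine ⟨integral_exp_pos hi, ?_⟩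
  rw [ofReal_integral_eq_lintegral_ofReal hi (ae_of_all _ fun x => (exp_pos _).le)]
  refine lintegral_congr fun x => ?_
  conv_lhs => rw [he x]
  rw [ENNReal.ofReal_rpow_of_pos (exp_pos _), mul_comm m, exp_mul]

lemma ennreal_core (F G H : ℝ → ℝ≥0∞) (hF : Measurable F) (hG : Measurable G)
    (hH : Measurable H) (a b : ℝ) (ha : 0 < a) 
    (hF1 : ∀ x, ENNReal.ofReal a ≤ F x) (hF2 : ∀ x, F x ≤ ENNReal.ofReal b)
    (hG1 : ∀ x, ENNReal.ofReal a ≤ G x) (hG2 : ∀ x, G x ≤ ENNReal.ofReal b)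
    (hH1 : ∀ x, ENNReal.ofReal a ≤ H x) (hH2 : ∀ x, H x ≤ ENNReal.ofReal b)
    (m₀ m₁ : ℝ) (hm₀ : 0 < m₀) (hm₁ : 0 < m₁) (l : ℝ) (hl : l ∈ Icc (0 : ℝ) 1)
    (hyp : ∀ x y : ℝ, F ((1 - l) * x + l * y) ≤ G x ^ (1 - l) * H y ^ l) :
    (∫⁻ z, F z ^ ((1 - l) * m₀ + l * m₁) ∂(gaussianReal 0 1))
        ^ (1 / ((1 - l) * m₀ + l * m₁)) ≤
      (∫⁻ z, G z ^ m₀ ∂(gaussianReal 0 1)) ^ ((1 - l) / m₀) *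
        (∫⁻ z, H z ^ m₁ ∂(gaussianReal 0 1)) ^ (l / m₁) := by
  obtain ⟨mF, bF, eF, iF⟩ := toReal_log_facts hF ha hF1 hF2
  obtain ⟨mG, bG, eG, iG⟩ := toReal_log_facts hG ha hG1 hG2
  obtain ⟨mH, bH, eH, iH⟩ := toReal_log_facts hH ha hH1 hH2
  have hm : 0 < (1 - l) * m₀ + l * m₁ := by
    rcases hl.1.eq_or_lt with h0 | h0
    · rw [← h0]; linarith
    · nlinarith [mul_pos h0 hm₁, mul_nonneg (sub_nonneg.2 hl.2) hm₀.le]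
  have core := bdd_core _ _ _ mF mG mH _ bF bG bH m₀ m₁ l hm₀ hm₁ hl (fun x y => by
    have h := hyp x y
    rw [eF, eG, eH, ENNReal.ofReal_rpow_of_pos (exp_pos _), ENNReal.ofReal_rpow_of_pos (exp_pos _),
      ← exp_mul, ← exp_mul, ← ENNReal.ofReal_mul (exp_pos _).le, ← exp_add, 
      ENNReal.ofReal_le_ofReal_iff (exp_pos _).le, exp_le_exp] at h
    linarith)
  obtain ⟨pF, qF⟩ := iF _ hm
  obtain ⟨pG, qG⟩ := iG _ hm₀
  obtain ⟨pH, qH⟩ := iH _ hm₁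
  rw [qF, qG, qH, ENNReal.ofReal_rpow_of_pos pF, ENNReal.ofReal_rpow_of_pos pG, ENNReal.ofReal_rpow_of_pos pH,
    ← ENNReal.ofReal_mul (by positivity)]
  apply ENNReal.ofReal_le_ofReal
  rw [rpow_def_of_pos pF, rpow_def_of_pos pG, rpow_def_of_pos pH, ← exp_add, exp_le_exp]
  rw [mul_one_div]
  linarith

lemma exists_big (l η N : ℝ) (hl0 : 0 < l) (hl1 : l < 1) (hη : 0 < η) :
    ∃ b : ℝ, N ≤ b ∧ η ≤ b ∧ N ≤ b ^ (1 - l) * η ^ l ∧ N ≤ η ^ (1 - l) * b ^ l := by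
  have t1 := (tendsto_rpow_atTop (sub_pos.2 hl1)).atTop_mul_const (rpow_pos_of_pos hη l)
  have t2 := (tendsto_rpow_atTop hl0).const_mul_atTop (rpow_pos_of_pos hη (1 - l))
  obtain ⟨b, h⟩ := ((Filter.eventually_ge_atTop N).and ((Filter.eventually_ge_atTop η).and
    ((t1.eventually_ge_atTop N).and (t2.eventually_ge_atTop N)))).exists
  exact ⟨b, h⟩

lemma trunc_core (F G H : ℝ → ℝ≥0∞) (hF : Measurable F) (hG : Measurable G)
    (hH : Measurable H) 
    (m₀ m₁ : ℝ) (hm₀ : 0 < m₀) (hm₁ : 0 < m₁) (l : ℝ) (hl0 : 0 < l) (hl1 : l < 1)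
    (hyp : ∀ x y : ℝ, F ((1 - l) * x + l * y) ≤ G x ^ (1 - l) * H y ^ l) 
    (η N : ℝ) (hη : 0 < η) (hηN : η ≤ N) :
    (∫⁻ z, (min (F z) (ENNReal.ofReal N)) ^ ((1 - l) * m₀ + l * m₁) ∂(gaussianReal 0 1))
        ^ (1 / ((1 - l) * m₀ + l * m₁)) ≤
      (∫⁻ z, G z ^ m₀ ∂(gaussianReal 0 1) + ENNReal.ofReal η ^ m₀) ^ ((1 - l) / m₀) *
        (∫⁻ z, H z ^ m₁ ∂(gaussianReal 0 1) + ENNReal.ofReal η ^ m₁) ^ (l / m₁) := by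
  obtain ⟨b, hNb, hηb, hb1, hb2⟩ := exists_big l η N hl0 hl1 hη
  have hb0 : 0 < b := hη.trans_le hηb
  have hl1' : 0 < 1 - l := sub_pos.2 hl1
  have hm : 0 < (1 - l) * m₀ + l * m₁ := by positivity
  set E := ENNReal.ofReal η with hE
  set B := ENNReal.ofReal b with hB
  set NN := ENNReal.ofReal N with hNN
  have EB : E ≤ B := ENNReal.ofReal_le_ofReal hηb
  have NB : NN ≤ B := ENNReal.ofReal_le_ofReal hNb
  have EN : E ≤ NN := ENNReal.ofReal_le_ofReal hηN
  have e1 : NN ≤ B ^ (1 - l) * E ^ l := by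
    rw [hB, hE, ENNReal.ofReal_rpow_of_pos hb0, ENNReal.ofReal_rpow_of_pos hη, ← ENNReal.ofReal_mul (by positivity)]
    exact ENNReal.ofReal_le_ofReal hb1
  have e2 : NN ≤ E ^ (1 - l) * B ^ l := by
    rw [hB, hE, ENNReal.ofReal_rpow_of_pos hb0, ENNReal.ofReal_rpow_of_pos hη, ← ENNReal.ofReal_mul (by positivity)]
    exact ENNReal.ofReal_le_ofReal hb2
  have main := ennreal_core (fun x => max (min (F x) NN) E) (fun x => min (max (G x) E) B) 
    (fun x => min (max (H x) E) B) (by fun_prop) (by fun_prop) (by fun_prop) η b hη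
    (fun x => le_max_right _ _) (fun x => max_le ((min_le_right _ _).trans NB) EB)
    (fun x => le_min (le_max_right _ _) EB) (fun x => min_le_right _ _)
    (fun x => le_min (le_max_right _ _) EB) (fun x => min_le_right _ _) m₀ m₁ hm₀ hm₁ l ⟨hl0.le, hl1.le⟩
    (fun x y => by
      have hle : max (min (F ((1 - l) * x + l * y)) NN) E ≤ NN := max_le (min_le_right _ _) EN
      rcases le_total (max (G x) E) B with hg | hg
      · rcases le_total (max (H y) E) B with hh | hh
        · rw [min_eq_left hg, min_eq_left hh]
          refine max_le ((min_le_left _ _).trans ((hyp x y).trans ?_)) ?_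
          · gcongr
            · exact le_max_left _ _
            · exact le_max_left _ _
          · calc E = E ^ (1 - l) * E ^ l := by
                  rw [← ENNReal.rpow_add _ _ (by simpa [hE] using hη) (by simp [hE])]; simp
              _ ≤ _ := by
                gcongr
                · exact le_max_right _ _
                · exact le_max_right _ _
        · rw [min_eq_right hh]
          refine hle.trans (e2.trans ?_)
          gcongr
          exact le_min (le_max_right _ _) EB
      · rw [min_eq_right hg]
        refine hle.trans (e1.trans ?_)
        gcongr
        exact le_min (le_max_right _ _) EB)
  have up : ∀ (q : ℝ → ℝ≥0∞) (c : ℝ), Measurable q → 0 < c → 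
      ∫⁻ z, (min (max (q z) E) B) ^ c ∂(gaussianReal 0 1) ≤ ∫⁻ z, q z ^ c ∂(gaussianReal 0 1) + E ^ c := by
    intro q c mq hc
    calc _ ≤ ∫⁻ z, (q z ^ c + E ^ c) ∂(gaussianReal 0 1) := by
          refine lintegral_mono fun z => ?_
          refine (ENNReal.rpow_le_rpow (min_le_left _ _) hc.le).trans ?_
          rcases le_total (q z) E with h | h
          · rw [max_eq_right h]; exact le_add_self
          · rw [max_eq_left h]; exact le_self_add
      _ = _ := by
          rw [lintegral_add_right _ measurable_const]; simp
  refine le_trans ?_ (main.trans ?_)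
  · gcongr
    exact le_max_left _ _
  · gcongr
    · exact up G m₀ hG hm₀
    · exact up H m₁ hH hm₁

/-- **Gaussian inequality.** If nonnegative measurable `F, G, H` on `ℝ` satisfy
`F((1-λ)x + λy) ≤ G(x)^{1-λ} H(y)^λ` for all `x, y` and `λ ∈ [0,1]`, then for
`m₀, m₁ > 0`, `λ ∈ [0,1]` and `m_λ = (1-λ)m₀ + λm₁`,
`(E F(z)^{m_λ})^{1/m_λ} ≤ (E G(z)^{m₀})^{(1-λ)/m₀} (E H(z)^{m₁})^{λ/m₁}`
for a standard Gaussian `z`. -/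
theorem stmt0 (F G H : ℝ → ℝ≥0∞) (hF : Measurable F) (hG : Measurable G)
    (hH : Measurable H)
    (hyp : ∀ x y : ℝ, ∀ l : ℝ, l ∈ Icc (0 : ℝ) 1 →
      F ((1 - l) * x + l * y) ≤ G x ^ (1 - l) * H y ^ l)
    (m₀ m₁ : ℝ) (hm₀ : 0 < m₀) (hm₁ : 0 < m₁) (l : ℝ) (hl : l ∈ Icc (0 : ℝ) 1) :
    (∫⁻ z, F z ^ ((1 - l) * m₀ + l * m₁) ∂(gaussianReal 0 1))
        ^ (1 / ((1 - l) * m₀ + l * m₁)) ≤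
      (∫⁻ z, G z ^ m₀ ∂(gaussianReal 0 1)) ^ ((1 - l) / m₀) *
        (∫⁻ z, H z ^ m₁ ∂(gaussianReal 0 1)) ^ (l / m₁) := by
  obtain ⟨hl0, hl1⟩ := hl
  have hFG : ∀ x, F x ≤ G x := fun x => by simpa using hyp x x 0 (by simp)
  have hFH : ∀ x, F x ≤ H x := fun x => by simpa using hyp x x 1 (by simp)
  rcases hl0.eq_or_lt with h0 | h0
  · subst h0
    simp only [sub_zero, one_mul, zero_mul, add_zero, zero_div, ENNReal.rpow_zero, mul_one]
    gcongr
    exact hFG _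
  rcases hl1.eq_or_lt with h1 | h1
  · subst h1
    simp only [sub_self, one_mul, zero_mul, zero_add, zero_div, ENNReal.rpow_zero]
    gcongr
    exact hFH _
  have hl1' : 0 < 1 - l := sub_pos.2 h1
  have hm : 0 < (1 - l) * m₀ + l * m₁ := by positivity
  have zero : ∀ (q : ℝ → ℝ≥0∞) (c : ℝ), Measurable q → 0 < c → (∀ x, F x ≤ q x) → 
      ∫⁻ z, q z ^ c ∂(gaussianReal 0 1) = 0 → 
      (∫⁻ z, F z ^ ((1 - l) * m₀ + l * m₁) ∂(gaussianReal 0 1))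
        ^ (1 / ((1 - l) * m₀ + l * m₁)) = 0 := by
    intro q c mq hc hq h
    rw [lintegral_eq_zero_iff (by fun_prop)] at h
    have : ∫⁻ z, F z ^ ((1 - l) * m₀ + l * m₁) ∂(gaussianReal 0 1) = 0 := by
      rw [lintegral_eq_zero_iff (by fun_prop)]
      filter_upwards [h] with x hx
      have hx' : q x = 0 := by
        simpa [ENNReal.rpow_eq_zero_iff, hc, hc.not_gt] using hx
      have : F x = 0 := le_antisymm ((hq x).trans hx'.le) (zero_le)
      simp [this, hm]
    rw [this, ENNReal.zero_rpow_of_pos (by positivity)]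
  by_cases hA0 : ∫⁻ z, G z ^ m₀ ∂(gaussianReal 0 1) = 0
  · rw [zero G m₀ hG hm₀ hFG hA0]; exact zero_le
  by_cases hB0 : ∫⁻ z, H z ^ m₁ ∂(gaussianReal 0 1) = 0
  · rw [zero H m₁ hH hm₁ hFH hB0]; exact zero_le
  have pA : 0 < (1 - l) / m₀ := by positivity
  have pB : 0 < l / m₁ := by positivity
  by_cases hAt : ∫⁻ z, G z ^ m₀ ∂(gaussianReal 0 1) = ⊤
  · rw [hAt, ENNReal.top_rpow_of_pos pA, ENNReal.top_mul]
    · exact le_top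
    · simp [ENNReal.rpow_eq_zero_iff, hB0, pB.not_gt]
  by_cases hBt : ∫⁻ z, H z ^ m₁ ∂(gaussianReal 0 1) = ⊤
  · rw [hBt, ENNReal.top_rpow_of_pos pB, ENNReal.mul_top]
    · exact le_top
    · simp [ENNReal.rpow_eq_zero_iff, hA0, pA.not_gt]
  have hT : ∀ n : ℕ, (∫⁻ z, (min (F z) (ENNReal.ofReal ((n : ℝ) + 1))) ^ ((1 - l) * m₀ + l * m₁) ∂(gaussianReal 0 1))
        ^ (1 / ((1 - l) * m₀ + l * m₁)) ≤ (∫⁻ z, G z ^ m₀ ∂(gaussianReal 0 1)) ^ ((1 - l) / m₀) *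
        (∫⁻ z, H z ^ m₁ ∂(gaussianReal 0 1)) ^ (l / m₁) := by
    intro n
    have hs : ∀ (A : ℝ≥0∞) (c d : ℝ), 0 < c → Filter.Tendsto (fun j : ℕ => (A + ENNReal.ofReal (1 / ((j : ℝ) + 1)) ^ c) ^ d)
        Filter.atTop (nhds (A ^ d)) := by
      intro A c d hc
      have t0 := ENNReal.tendsto_ofReal (tendsto_one_div_add_atTop_nhds_zero_nat (𝕜 := ℝ))
      have t1 := t0.ennrpow_const c
      rw [ENNReal.ofReal_zero, ENNReal.zero_rpow_of_pos hc] at t1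
      have t2 := (t1.const_add A).ennrpow_const d
      rwa [add_zero] at t2
    have t := ENNReal.Tendsto.mul (hs (∫⁻ z, G z ^ m₀ ∂(gaussianReal 0 1)) m₀ ((1 - l) / m₀) hm₀)
      (Or.inr (ENNReal.rpow_ne_top_of_nonneg pB.le hBt))
      (hs (∫⁻ z, H z ^ m₁ ∂(gaussianReal 0 1)) m₁ (l / m₁) hm₁)
      (Or.inr (ENNReal.rpow_ne_top_of_nonneg pA.le hAt))
    refine ge_of_tendsto' t fun j => ?_
    refine trunc_core F G H hF hG hH m₀ m₁ hm₀ hm₁ l h0 h1 (fun x y => hyp x y l ⟨hl0, hl1⟩) _ _ (by positivity) ?_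
    have : 1 / ((j : ℝ) + 1) ≤ 1 := by
      rw [div_le_one (by positivity)]; linarith [Nat.cast_nonneg (α := ℝ) j]
    linarith [Nat.cast_nonneg (α := ℝ) n]
  have mono : Filter.Tendsto (fun n : ℕ => ∫⁻ z, (min (F z) (ENNReal.ofReal ((n : ℝ) + 1))) ^ ((1 - l) * m₀ + l * m₁) ∂(gaussianReal 0 1))
      Filter.atTop (nhds (∫⁻ z, F z ^ ((1 - l) * m₀ + l * m₁) ∂(gaussianReal 0 1))) := by
    refine lintegral_tendsto_of_tendsto_of_monotone (fun n => by fun_prop) (ae_of_all _ fun x => ?_) (ae_of_all _ fun x => ?_)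
    · intro i j hij
      simp only
      gcongr
    · refine Filter.Tendsto.ennrpow_const _ ?_
      have : Filter.Tendsto (fun n : ℕ => ENNReal.ofReal ((n : ℝ) + 1)) Filter.atTop (nhds ⊤) :=
        ENNReal.tendsto_ofReal_atTop.comp (Filter.tendsto_atTop_add_const_right _ _ tendsto_natCast_atTop_atTop)
      have t := (tendsto_const_nhds (x := F x)).min this
      simpa using t
  exact le_of_tendsto' (mono.ennrpow_const _) hT
end

section
/- Let z be a standard Gaussian random variable and let f : ℝ → ℝ be convex, bounded below, and such that E[exp(m f(z))] < ∞ for every m > 0. Then the function φ(m) = (1/m) log E[exp(m f(z))] is convex on (0,∞): for all m₀, m₁ > 0 and λ ∈ [0,1], φ((1−λ)m₀ + λm₁) ≤ (1−λ)φ(m₀) + λφ(m₁). -/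
open MeasureTheory ProbabilityTheory Real Set
open Filter Topology

lemma cdf_exists (w : ℝ → ℝ) (hw : Continuous w) (hi : Integrable w) (h1 : ∫ x, w x = 1) :
    ∃ W : ℝ → ℝ, (∀ y, HasDerivAt W (w y) y) ∧ Tendsto W atBot (𝓝 0) ∧ Tendsto W atTop (𝓝 1) := by
  refine ⟨fun y => (∫ x in (0:ℝ)..y, w x) + ∫ x in Iic 0, w x, ?_, ?_, ?_⟩
  · intro y
    exact (intervalIntegral.integral_hasDerivAt_right (hw.intervalIntegrable _ _)
      hw.stronglyMeasurable.stronglyMeasurableAtFilter hw.continuousAt).add_const _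
  · have h := intervalIntegral_tendsto_integral_Iic (0:ℝ) hi.integrableOn tendsto_id
    have h2 := (h.neg).add_const (∫ x in Iic 0, w x)
    rw [neg_add_cancel] at h2
    refine h2.congr fun y => ?_
    simp only [id]
    rw [intervalIntegral.integral_symm, neg_neg]
  · have h := intervalIntegral_tendsto_integral_Ioi (0:ℝ) hi.integrableOn tendsto_id
    have h2 := h.add_const (∫ x in Iic 0, w x)
    rw [add_comm (∫ x in Ioi 0, w x), intervalIntegral.integral_Iic_add_Ioi hi.integrableOn
      hi.integrableOn, h1] at h2
    exact h2

lemma cdf_props (w W : ℝ → ℝ) (hw : ∀ x, 0 < w x) (hW : ∀ y, HasDerivAt W (w y) y)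
    (hb : Tendsto W atBot (𝓝 0)) (ht : Tendsto W atTop (𝓝 1)) :
    StrictMono W ∧ (∀ x, W x ∈ Ioo (0:ℝ) 1) ∧ ∀ p ∈ Ioo (0:ℝ) 1, ∃ x, W x = p := by
  have hs : StrictMono W := strictMono_of_deriv_pos fun x => by rw [(hW x).deriv]; exact hw x
  have hc : Continuous W := continuous_iff_continuousAt.2 fun x => (hW x).continuousAt
  refine ⟨hs, fun x => ⟨?_, ?_⟩, fun p hp => ?_⟩
  · exact lt_of_le_of_lt (hs.monotone.le_of_tendsto hb (x - 1)) (hs (by linarith))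
  · exact lt_of_lt_of_le (hs (by linarith : x < x + 1)) (hs.monotone.ge_of_tendsto ht (x + 1))
  · obtain ⟨a, ha⟩ := (hb.eventually (gt_mem_nhds hp.1)).exists
    obtain ⟨b, hb⟩ := (ht.eventually (lt_mem_nhds hp.2)).exists
    exact mem_range_of_exists_le_of_exists_ge hc ⟨a, ha.le⟩ ⟨b, hb.le⟩

lemma transport_exists (w W v V : ℝ → ℝ) (hw : ∀ x, 0 < w x) (hW : ∀ y, HasDerivAt W (w y) y)
    (hb : Tendsto W atBot (𝓝 0)) (ht : Tendsto W atTop (𝓝 1))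
    (hv : ∀ x, 0 < v x) (hV : ∀ y, HasDerivAt V (v y) y)
    (hVb : Tendsto V atBot (𝓝 0)) (hVt : Tendsto V atTop (𝓝 1)) :
    ∃ T : ℝ → ℝ, ∀ x, W (T x) = V x ∧ HasDerivAt T (v x / w (T x)) x := by
  obtain ⟨hs, hm, hsur⟩ := cdf_props w W hw hW hb ht
  obtain ⟨-, hVm, -⟩ := cdf_props v V hv hV hVb hVt
  have hG : ∀ p : ℝ, ∃ x, p ∈ Ioo (0:ℝ) 1 → W x = p := fun p => by
    by_cases hp : p ∈ Ioo (0:ℝ) 1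
    · obtain ⟨x, hx⟩ := hsur p hp
      exact ⟨x, fun _ => hx⟩
    · exact ⟨0, fun h => absurd h hp⟩
  choose G hG using hG
  have hGW : ∀ x, G (W x) = x := fun x => hs.injective (hG _ (hm x))
  have hGm : StrictMonoOn G (Ioo 0 1) := fun p hp q hq hpq => by
    rw [← hs.lt_iff_lt, hG p hp, hG q hq]; exact hpq
  have hGd : ∀ p ∈ Ioo (0:ℝ) 1, HasDerivAt G (w (G p))⁻¹ p := fun p hp => by
    have hn : Ioo (0:ℝ) 1 ∈ 𝓝 p := Ioo_mem_nhds hp.1 hp.2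
    refine HasDerivAt.of_local_left_inverse ?_ (hW (G p)) (hw _).ne' ?_
    · refine hGm.continuousAt_of_image_mem_nhds hn ?_
      have : G '' Ioo 0 1 = univ := eq_univ_of_forall fun x => ⟨W x, hm x, hGW x⟩
      rw [this]; exact univ_mem
    · filter_upwards [hn] with q hq using hG q hq
  refine ⟨fun x => G (V x), fun x => ⟨hG _ (hVm x), ?_⟩⟩
  have := (hGd (V x) (hVm x)).comp x (hV x)
  rw [div_eq_inv_mul]
  exact this

lemma no_cross (H H' : ℝ → ℝ) (hH : ∀ y, HasDerivAt H (H' y) y)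
    (hb : Tendsto H atBot (𝓝 0)) (ht : Tendsto H atTop (𝓝 0))
    (hconv : ∀ a b c, a < b → b < c → H' a < 0 → H' c < 0 → H' b < 0)
    (y₁ y₂ : ℝ) (hy : y₁ < y₂) (h1 : H y₁ < 0) (h2 : 0 < H y₂) : False := by
  have hc : Continuous H := continuous_iff_continuousAt.2 fun x => (hH x).continuousAt
  obtain ⟨a, ha, ha'⟩ := ((hb.eventually (lt_mem_nhds h1)).and (eventually_lt_atBot y₁)).exists
  obtain ⟨b, hb, hb'⟩ := ((ht.eventually (gt_mem_nhds h2)).and (eventually_gt_atTop y₂)).exists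
  obtain ⟨p, hp, hp'⟩ := exists_hasDerivAt_eq_slope H H' ha' hc.continuousOn (fun x _ => hH x)
  obtain ⟨q, hq, hq'⟩ := exists_hasDerivAt_eq_slope H H' hy hc.continuousOn (fun x _ => hH x)
  obtain ⟨r, hr, hr'⟩ := exists_hasDerivAt_eq_slope H H' hb' hc.continuousOn (fun x _ => hH x)
  have e1 : H' p < 0 := by rw [hp']; exact div_neg_of_neg_of_pos (by linarith) (by linarith)
  have e2 : 0 < H' q := by rw [hq']; exact div_pos (by linarith) (by linarith)
  have e3 : H' r < 0 := by rw [hr']; exact div_neg_of_neg_of_pos (by linarith) (by linarith)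
  have := hconv p q r (hp.2.trans hq.1) (hq.2.trans hr.1) e1 e3
  linarith

lemma expansion (k : ℝ) (hk : 0 < k) (g W V T : ℝ → ℝ) (hg : ConvexOn ℝ univ g)
    (hW : ∀ y, HasDerivAt W (k * exp (-y ^ 2 / 2) * exp (g y)) y)
    (hb : Tendsto W atBot (𝓝 0)) (ht : Tendsto W atTop (𝓝 1))
    (hV : ∀ y, HasDerivAt V (k * exp (-y ^ 2 / 2)) y)
    (hVb : Tendsto V atBot (𝓝 0)) (hVt : Tendsto V atTop (𝓝 1))
    (hT : ∀ x, W (T x) = V x) : Monotone (fun x => T x - x) := by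
  obtain ⟨hWs, -, -⟩ := cdf_props _ W (fun x => by positivity) hW hb ht
  obtain ⟨hVs, -, -⟩ := cdf_props _ V (fun x => by positivity) hV hVb hVt
  intro x₁ x₂ hx
  by_contra hcon
  push Not at hcon
  have hx' : x₁ < x₂ := lt_of_le_of_ne hx (by rintro rfl; exact lt_irrefl _ hcon)
  obtain ⟨c, hc1, hc2⟩ := exists_between hcon
  have hTT : T x₁ < T x₂ := by rw [← hWs.lt_iff_lt, hT, hT]; exact hVs hx'
  refine no_cross (fun y => W y - V (y - c))
    (fun y => k * exp (-y ^ 2 / 2) * exp (g y) - k * exp (-(y - c) ^ 2 / 2)) ?_ ?_ ?_ ?_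
    (T x₁) (T x₂) hTT ?_ ?_
  · intro y
    exact (hW y).sub ((hV (y - c)).comp_sub_const y c)
  · simpa [← sub_eq_add_neg] using hb.sub (hVb.comp (tendsto_atBot_add_const_right _ (-c) tendsto_id))
  · simpa [← sub_eq_add_neg] using ht.sub (hVt.comp (tendsto_atTop_add_const_right _ (-c) tendsto_id))
  · have key : ∀ y, k * exp (-y ^ 2 / 2) * exp (g y) - k * exp (-(y - c) ^ 2 / 2) < 0 ↔
        g y < c * y - c ^ 2 / 2 := by
      intro y
      rw [sub_neg, mul_assoc, mul_lt_mul_iff_right₀ hk, ← exp_add, exp_lt_exp]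
      constructor <;> intro h <;> nlinarith
    intro a b d hab hbd h1 h2
    rw [key] at h1 h2 ⊢
    have hda : 0 < d - a := by linarith
    have w1 : 0 ≤ (d - b) / (d - a) := div_nonneg (by linarith) hda.le
    have w2 : 0 ≤ (b - a) / (d - a) := div_nonneg (by linarith) hda.le
    have hh := hg.2 (mem_univ a) (mem_univ d) w1 w2 (by field_simp; ring)
    simp only [smul_eq_mul] at hh
    have e : (d - b) / (d - a) * a + (b - a) / (d - a) * d = b := by field_simp; ring
    rw [e] at hh
    have p1 : 0 < (d - b) / (d - a) := div_pos (by linarith) hda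
    have p2 : 0 < (b - a) / (d - a) := div_pos (by linarith) hda
    have s1 : (d - b) / (d - a) + (b - a) / (d - a) = 1 := by field_simp; ring
    have q1 := mul_lt_mul_of_pos_left h1 p1
    have q2 := mul_lt_mul_of_pos_left h2 p2
    set u := (d - b) / (d - a)
    set v := (b - a) / (d - a)
    have : u * (c * a - c ^ 2 / 2) + v * (c * d - c ^ 2 / 2)
        = c * (u * a + v * d) - (u + v) * (c ^ 2 / 2) := by ring
    rw [e, s1] at this
    linarith
  · simp only [sub_neg, hT]
    exact hVs (by linarith)
  · simp only [sub_pos, hT]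
    exact hVs (by linarith)

lemma log_div_integral (a m : ℝ) (ha : 0 ≤ a) (hm : 0 < m) :
    log (1 + m * a) / m = ∫ s in (0:ℝ)..1, a / (1 + s * m * a) := by
  have hpos : ∀ s ∈ uIcc (0:ℝ) 1, 0 < 1 + s * m * a := fun s hs => by
    rw [uIcc_of_le zero_le_one] at hs
    have := hs.1
    positivity
  have := intervalIntegral.integral_eq_sub_of_hasDerivAt (a := 0) (b := 1)
    (f := fun s => log (1 + s * m * a) / m) (f' := fun s => a / (1 + s * m * a)) ?_ ?_
  · rw [this]; simp
  · intro s hs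
    have h1 : HasDerivAt (fun s : ℝ => 1 + s * m * a) (1 * m * a) s :=
      (((hasDerivAt_id s).mul_const m).mul_const a).const_add 1
    have h2 := (h1.log (hpos s hs).ne').div_const m
    have e : 1 * m * a / (1 + s * m * a) / m = a / (1 + s * m * a) := by
      rw [one_mul, div_right_comm, mul_div_cancel_left₀ _ hm.ne']
    rw [← e]
    exact h2
  · apply ContinuousOn.intervalIntegrable
    exact continuousOn_const.div (by fun_prop) fun s hs => (hpos s hs).ne'

lemma log_div_convex (a m₀ m₁ l : ℝ) (ha : 0 ≤ a) (hm₀ : 0 < m₀) (hm₁ : 0 < m₁)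
    (hl : l ∈ Icc (0 : ℝ) 1) (hm : 0 < (1 - l) * m₀ + l * m₁) :
    log (1 + ((1 - l) * m₀ + l * m₁) * a) / ((1 - l) * m₀ + l * m₁) ≤
      (1 - l) * (log (1 + m₀ * a) / m₀) + l * (log (1 + m₁ * a) / m₁) := by
  rw [log_div_integral a _ ha hm, log_div_integral a _ ha hm₀, log_div_integral a _ ha hm₁]
  have ii : ∀ m : ℝ, 0 < m → IntervalIntegrable (fun s => a / (1 + s * m * a)) volume 0 1 := by
    intro m hm
    apply ContinuousOn.intervalIntegrable
    refine continuousOn_const.div (by fun_prop) fun s hs => ?_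
    rw [uIcc_of_le zero_le_one] at hs
    have := hs.1
    positivity
  rw [← intervalIntegral.integral_const_mul, ← intervalIntegral.integral_const_mul,
    ← intervalIntegral.integral_add ((ii _ hm₀).const_mul _) ((ii _ hm₁).const_mul _)]
  refine intervalIntegral.integral_mono_on zero_le_one (ii _ hm)
    (((ii _ hm₀).const_mul _).add ((ii _ hm₁).const_mul _)) fun s hs => ?_
  have hs0 := hs.1
  have hl0 := hl.1
  have hl1 : 0 ≤ 1 - l := by linarith [hl.2]
  have hx : 0 < 1 + s * m₀ * a := by positivity
  have hy : 0 < 1 + s * m₁ * a := by positivity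
  have e : 1 + s * ((1 - l) * m₀ + l * m₁) * a
      = (1 - l) * (1 + s * m₀ * a) + l * (1 + s * m₁ * a) := by ring
  rw [e]
  have hc := (convexOn_zpow (𝕜 := ℝ) (-1)).2 (mem_Ioi.2 hx) (mem_Ioi.2 hy) hl1 hl0 (by ring)
  simp only [smul_eq_mul, zpow_neg_one] at hc
  have := mul_le_mul_of_nonneg_left hc ha
  simp only [div_eq_mul_inv]
  linarith

lemma change_var (w T T' : ℝ → ℝ) (hw : Integrable w) (hw0 : ∀ x, 0 ≤ w x)
    (hT : ∀ x, HasDerivAt T (T' x) x) (hT' : ∀ x, 0 < T' x) :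
    Integrable (fun x => T' x * w (T x)) ∧ ∫ x, T' x * w (T x) ≤ ∫ x, w x := by
  have hs : StrictMono T := strictMono_of_deriv_pos fun x => by rw [(hT x).deriv]; exact hT' x
  have h1 := integrableOn_image_iff_integrableOn_abs_deriv_smul MeasurableSet.univ
    (fun x _ => (hT x).hasDerivWithinAt) hs.injective.injOn w
  have h2 := integral_image_eq_integral_abs_deriv_smul MeasurableSet.univ
    (fun x _ => (hT x).hasDerivWithinAt) hs.injective.injOn w
  simp only [abs_of_pos (hT' _), smul_eq_mul, integrableOn_univ, setIntegral_univ] at h1 h2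
  refine ⟨h1.1 hw.integrableOn, ?_⟩
  rw [← h2]
  exact setIntegral_le_integral hw (ae_of_all _ hw0)

/-- For `z` standard Gaussian and `f : ℝ → ℝ` convex, bounded below, with
`E exp(m f(z)) < ∞` for all `m > 0`, the function
`φ(m) = (1/m) log E exp(m f(z))` is convex on `(0,∞)`. -/
theorem stmt1 (f : ℝ → ℝ) (hconv : ConvexOn ℝ Set.univ f)
    (hbd : ∃ c : ℝ, ∀ x : ℝ, c ≤ f x)
    (hint : ∀ m : ℝ, 0 < m →
      Integrable (fun z => Real.exp (m * f z)) (gaussianReal 0 1))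
    (m₀ m₁ l : ℝ) (hm₀ : 0 < m₀) (hm₁ : 0 < m₁) (hl : l ∈ Icc (0 : ℝ) 1) :
    (1 / ((1 - l) * m₀ + l * m₁)) *
        Real.log (∫ z, Real.exp (((1 - l) * m₀ + l * m₁) * f z) ∂(gaussianReal 0 1)) ≤
      (1 - l) * ((1 / m₀) * Real.log (∫ z, Real.exp (m₀ * f z) ∂(gaussianReal 0 1))) +
        l * ((1 / m₁) * Real.log (∫ z, Real.exp (m₁ * f z) ∂(gaussianReal 0 1))) := by
  have hl0 := hl.1
  have hl1 : 0 ≤ 1 - l := by linarith [hl.2]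
  have hm : 0 < (1 - l) * m₀ + l * m₁ := by
    rcases hl0.eq_or_lt with h | h
    · rw [← h]; simpa using hm₀
    · have : 0 ≤ (1 - l) * m₀ := by positivity
      have : 0 < l * m₁ := by positivity
      linarith
  have hfc : Continuous f := by
    rw [← continuousOn_univ]; exact hconv.continuousOn isOpen_univ
  -- Gaussian density
  obtain ⟨k, hk, hp⟩ : ∃ k : ℝ, 0 < k ∧ gaussianPDFReal 0 1 = fun y => k * exp (-y ^ 2 / 2) := by
    refine ⟨(√(2 * π))⁻¹, by positivity, ?_⟩
    funext y
    simp [gaussianPDFReal]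
  have hpi : Integrable (fun y : ℝ => k * exp (-y ^ 2 / 2)) := hp ▸ integrable_gaussianPDFReal 0 1
  have hp1 : ∫ y : ℝ, k * exp (-y ^ 2 / 2) = 1 := by
    have := integral_gaussianPDFReal_eq_one 0 (v := 1) one_ne_zero
    rwa [hp] at this
  have hZeq : ∀ n : ℝ, ∫ z, exp (n * f z) ∂(gaussianReal 0 1)
      = ∫ y, k * exp (-y ^ 2 / 2) * exp (n * f y) := by
    intro n
    rw [integral_gaussianReal_eq_integral_smul one_ne_zero, hp]
    rfl
  have hZint : ∀ n : ℝ, 0 < n → Integrable (fun y => k * exp (-y ^ 2 / 2) * exp (n * f y)) := by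
    intro n hn
    have h := hint n hn
    rw [gaussianReal_of_var_ne_zero _ one_ne_zero,
      integrable_withDensity_iff_integrable_smul' (measurable_gaussianPDF 0 1)
        (ae_of_all _ fun _ => gaussianPDF_lt_top)] at h
    simpa only [toReal_gaussianPDF, smul_eq_mul, hp] using h
  simp only [hZeq]
  set Z : ℝ → ℝ := fun n => ∫ y, k * exp (-y ^ 2 / 2) * exp (n * f y) with hZ
  have hZpos : ∀ n, 0 < n → 0 < Z n := by
    intro n hn
    exact integral_pos_of_integrable_nonneg_nonzero (x := 0) (by fun_prop) (hZint n hn)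
      (fun y => by positivity) (by positivity)
  change 1 / _ * log (Z _) ≤ (1 - l) * (1 / m₀ * log (Z m₀)) + l * (1 / m₁ * log (Z m₁))
  set m := (1 - l) * m₀ + l * m₁ with hmdef
  have hwZ : ∀ y, k * exp (-y ^ 2 / 2) * exp (m * f y - log (Z m))
      = k * exp (-y ^ 2 / 2) * exp (m * f y) * (Z m)⁻¹ := by
    intro y
    rw [exp_sub, exp_log (hZpos m hm)]; ring
  obtain ⟨W, hW, hWb, hWt⟩ := cdf_exists
    (fun y => k * exp (-y ^ 2 / 2) * exp (m * f y - log (Z m))) (by fun_prop)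
    (by simp only [hwZ]; exact (hZint m hm).mul_const _)
    (by simp only [hwZ]; rw [integral_mul_const]; exact mul_inv_cancel₀ (hZpos m hm).ne')
  obtain ⟨V, hV, hVb, hVt⟩ := cdf_exists (fun y => k * exp (-y ^ 2 / 2)) (by fun_prop) hpi hp1
  obtain ⟨T, hT⟩ := transport_exists _ W _ V (fun x => by positivity) hW hWb hWt
    (fun x => by positivity) hV hVb hVt
  have hgc : ConvexOn ℝ univ (fun y => m * f y - log (Z m)) := by
    have := (hconv.smul hm.le).add_const (-log (Z m))
    simp only [sub_eq_add_neg]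
    exact this
  have hmono := expansion k hk _ W V T hgc hW hWb hWt hV hVb hVt (fun x => (hT x).1)
  set T' : ℝ → ℝ := fun x => k * exp (-x ^ 2 / 2) /
    (k * exp (-(T x) ^ 2 / 2) * exp (m * f (T x) - log (Z m))) with hT'
  have hTd : ∀ x, HasDerivAt T (T' x) x := fun x => (hT x).2
  have hT'1 : ∀ x, 1 ≤ T' x := by
    intro x
    have h1 := ((hTd x).sub (hasDerivAt_id x)).deriv
    have h2 : 0 ≤ deriv (fun x => T x - x) x := hmono.deriv_nonneg
    have h3 : deriv (fun x => T x - x) x = T' x - 1 := h1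
    linarith
  have hlogT' : ∀ x, log (T' x) = -x ^ 2 / 2 + (T x) ^ 2 / 2 - m * f (T x) + log (Z m) := by
    intro x
    have : T' x = exp (-x ^ 2 / 2 + (T x) ^ 2 / 2 - m * f (T x) + log (Z m)) := by
      simp only [hT']
      rw [div_eq_iff (by positivity), mul_assoc k, ← exp_add, mul_left_comm, ← exp_add]
      congr 2
      ring
    rw [this, log_exp]
  -- displacement
  set h : ℝ → ℝ := fun x => (T x - x) / m with hh
  set h' : ℝ → ℝ := fun x => (T' x - 1) / m with hh'
  have hhd : ∀ x, HasDerivAt h (h' x) x := fun x =>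
    ((hTd x).sub (hasDerivAt_id x)).div_const m
  have hh0 : ∀ x, 0 ≤ h' x := fun x => div_nonneg (by linarith [hT'1 x]) hm.le
  have hTh : ∀ x, T x = x + m * h x := fun x => by simp only [hh]; field_simp; ring
  have hTh' : ∀ x, T' x = 1 + m * h' x := fun x => by simp only [hh']; field_simp; ring
  -- bound for each n
  have hJ : ∀ n, 0 < n → ∃ J : ℝ → ℝ, Integrable J ∧ ∫ x, J x ≤ 1 ∧
      ∀ x, (k * exp (-x ^ 2 / 2)) * (f (x + n * h x) - x * h x - n * (h x) ^ 2 / 2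
        + log (1 + n * h' x) / n) ≤
        (k * exp (-x ^ 2 / 2)) * (1 / n * log (Z n) - 1 / n) + (1 / n) * J x := by
    intro n hn
    have hd : ∀ x, HasDerivAt (fun x => x + n * h x) (1 + n * h' x) x := fun x =>
      (hasDerivAt_id x).add ((hhd x).const_mul n)
    have hd0 : ∀ x, 0 < 1 + n * h' x := fun x => by have := hh0 x; positivity
    obtain ⟨c1, c2⟩ := change_var _ _ _ (hZint n hn) (fun y => by positivity) hd hd0
    refine ⟨_, c1.mul_const (Z n)⁻¹, ?_, fun x => ?_⟩
    · rw [integral_mul_const, mul_inv_le_iff₀ (hZpos n hn), one_mul]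
      exact c2
    · set A := f (x + n * h x) - x * h x - n * (h x) ^ 2 / 2 + log (1 + n * h' x) / n with hA
      have e1 : (1 + n * h' x) * (k * exp (-(x + n * h x) ^ 2 / 2) * exp (n * f (x + n * h x)))
          * (Z n)⁻¹ = k * exp (-x ^ 2 / 2) * exp (n * A - log (Z n)) := by
        have e2 : 1 + n * h' x = exp (log (1 + n * h' x)) := (exp_log (hd0 x)).symm
        have e3 : (Z n)⁻¹ = exp (-log (Z n)) := by rw [exp_neg, exp_log (hZpos n hn)]
        rw [e2, e3, mul_left_comm, mul_assoc, mul_assoc, mul_assoc, mul_assoc,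
          ← exp_add, ← exp_add, ← exp_add, ← exp_add]
        congr 2
        rw [hA]
        field_simp
        ring
      rw [e1]
      have e4 := add_one_le_exp (n * A - log (Z n))
      have e5 : A ≤ 1 / n * log (Z n) - 1 / n + 1 / n * exp (n * A - log (Z n)) := by
        have := mul_le_mul_of_nonneg_left e4 (by positivity : 0 ≤ 1 / n)
        have e6 : 1 / n * (n * A - log (Z n) + 1) = A - 1 / n * log (Z n) + 1 / n := by
          field_simp
        linarith
      have := mul_le_mul_of_nonneg_left e5 (by positivity : 0 ≤ k * exp (-x ^ 2 / 2))
      linarith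
  obtain ⟨J₀, i₀, b₀, p₀⟩ := hJ m₀ hm₀
  obtain ⟨J₁, i₁, b₁, p₁⟩ := hJ m₁ hm₁
  -- pointwise convexity
  have hpt : ∀ x, 1 / m * log (Z m) ≤
      (1 - l) * (f (x + m₀ * h x) - x * h x - m₀ * (h x) ^ 2 / 2 + log (1 + m₀ * h' x) / m₀)
      + l * (f (x + m₁ * h x) - x * h x - m₁ * (h x) ^ 2 / 2 + log (1 + m₁ * h' x) / m₁) := by
    intro x
    have q1 := log_div_convex (h' x) m₀ m₁ l (hh0 x) hm₀ hm₁ hl hm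
    rw [← hmdef, ← hTh' x, hlogT' x] at q1
    have q2 := hconv.2 (mem_univ (x + m₀ * h x)) (mem_univ (x + m₁ * h x)) hl1 hl0 (by ring)
    simp only [smul_eq_mul] at q2
    have q3 : (1 - l) * (x + m₀ * h x) + l * (x + m₁ * h x) = T x := by
      rw [hTh x, hmdef]; ring
    rw [q3] at q2
    have q4 : (-x ^ 2 / 2 + (T x) ^ 2 / 2 - m * f (T x) + log (Z m)) / m
        = x * h x + m * (h x) ^ 2 / 2 - f (T x) + 1 / m * log (Z m) := by
      have : (T x) ^ 2 = (x + m * h x) ^ 2 := by rw [← hTh x]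
      rw [this]
      field_simp
      ring
    rw [q4] at q1
    have q5 : m * (h x) ^ 2 / 2 = (1 - l) * (m₀ * (h x) ^ 2 / 2) + l * (m₁ * (h x) ^ 2 / 2) := by
      rw [hmdef]; ring
    linarith
  set C := (1 - l) * (1 / m₀ * log (Z m₀) - 1 / m₀) + l * (1 / m₁ * log (Z m₁) - 1 / m₁) with hC
  have hfin : ∫ x : ℝ, k * exp (-x ^ 2 / 2) * (1 / m * log (Z m)) ≤
      ∫ x : ℝ, (k * exp (-x ^ 2 / 2) * C + ((1 - l) * (1 / m₀) * J₀ x + l * (1 / m₁) * J₁ x)) := by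
    refine integral_mono (hpi.mul_const _)
      ((hpi.mul_const _).add ((i₀.const_mul _).add (i₁.const_mul _))) fun x => ?_
    have r1 := mul_le_mul_of_nonneg_left (hpt x) (by positivity : 0 ≤ k * exp (-x ^ 2 / 2))
    have r2 := mul_le_mul_of_nonneg_left (p₀ x) hl1
    have r3 := mul_le_mul_of_nonneg_left (p₁ x) hl0
    simp only [hC]
    linarith
  have i₂ : Integrable (fun x => (1 - l) * (1 / m₀) * J₀ x + l * (1 / m₁) * J₁ x) :=
    (i₀.const_mul _).add (i₁.const_mul _)
  rw [integral_add (hpi.mul_const _) i₂,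
    integral_add (i₀.const_mul _) (i₁.const_mul _), integral_mul_const, integral_mul_const,
    hp1, integral_const_mul, integral_const_mul] at hfin
  have r2 := mul_le_mul_of_nonneg_left b₀ (by positivity : 0 ≤ (1 - l) * (1 / m₀))
  have r3 := mul_le_mul_of_nonneg_left b₁ (by positivity : 0 ≤ l * (1 / m₁))
  simp only [hC] at hfin
  linarith
end
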